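/- (One-dimensional symmetry in the half-space.) Let N ≥ 1 and let f satisfy (H2). Let u be a bounded nonnegative C² solution of Δu + f(u) = 0 in ℝ^N₊ = ℝ^{N-1} × [0,+∞), continuous up to the boundary, with u = 0 on ℝ^{N-1} × {0}. Then u depends only on the last variable x_N; moreover, either u ≡ 0 in ℝ^N₊, or there exists z > 0 with f(z) = 0 such that u(x) = V_z(x_N) for all x ∈ ℝ^N₊. -/

import Mathlib

open Set Filter

noncomputable section

/-- Partial derivative of `u` in the `i`-th coordinate direction. -/
def pd {N : ℕ} (i : Fin N) (u : (Fin N → ℝ) → ℝ) (x : Fin N → ℝ) : ℝ :=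
  deriv (fun t => u (Function.update x i t)) (x i)

/-- Laplace operator: the sum of the pure second partial derivatives. -/
def lap {N : ℕ} (u : (Fin N → ℝ) → ℝ) (x : Fin N → ℝ) : ℝ :=
  ∑ i, pd i (pd i u) x

/-- `f` is locally Lipschitz-continuous on `[0, +∞)`. -/
def LocLipOn (f : ℝ → ℝ) : Prop :=
  ∀ b : ℝ, ∃ L : NNReal, LipschitzOnWith L f (Set.Icc 0 b)

/-- Hypothesis (H1): `f` is locally Lipschitz on `[0,∞)`, positive on `(0,μ)`, nonpositive on
`[μ,∞)`, nonincreasing on `[μ',μ]`, and either `f(0) > 0` or `f(0) = 0` with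
`liminf_{s→0⁺} f(s)/s > 0`. -/
def H1 (f : ℝ → ℝ) (μ' μ : ℝ) : Prop :=
  LocLipOn f ∧ 0 < μ' ∧ μ' < μ ∧
  (∀ s, 0 < s → s < μ → 0 < f s) ∧
  (∀ s, μ ≤ s → f s ≤ 0) ∧
  (∀ s t, μ' ≤ s → s ≤ t → t ≤ μ → f t ≤ f s) ∧
  (0 < f 0 ∨ (f 0 = 0 ∧ ∃ c > 0, ∀ᶠ s in nhdsWithin (0:ℝ) (Set.Ioi 0), c ≤ f s / s))

/-- Hypothesis (H2): `f` is locally Lipschitz and nonnegative on `[0,∞)`, and at every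
nonnegative zero `z` of `f`, `liminf_{s→z⁺} f(s)/(s-z) > 0`. -/
def H2 (f : ℝ → ℝ) : Prop :=
  LocLipOn f ∧ (∀ s, 0 ≤ s → 0 ≤ f s) ∧
  (∀ z, 0 ≤ z → f z = 0 → ∃ c > 0, ∀ᶠ s in nhdsWithin z (Set.Ioi z), c ≤ f s / (s - z))

/-- Hypothesis (H3): `liminf_{s→z⁻} f(s)/(s-z) > 0` for every zero `z > μ` of `f`. -/
def H3 (f : ℝ → ℝ) (μ : ℝ) : Prop :=
  ∀ z, μ < z → f z = 0 → ∃ c > 0, ∀ᶠ s in nhdsWithin z (Set.Iio z), c ≤ f s / (s - z)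

/-- `(V, V')` is a `C²` solution on `[0,+∞)` of `V'' + f(V) = 0` with `V(0) = 0`,
`0 < V < z` on `(0,+∞)` and `V(+∞) = z` (the one-dimensional profile `V_z`). -/
def IsProfile (f : ℝ → ℝ) (z : ℝ) (V V' : ℝ → ℝ) : Prop :=
  (∀ ξ ∈ Set.Ici (0:ℝ), HasDerivWithinAt V (V' ξ) (Set.Ici 0) ξ) ∧
  (∀ ξ ∈ Set.Ici (0:ℝ), HasDerivWithinAt V' (-(f (V ξ))) (Set.Ici 0) ξ) ∧
  V 0 = 0 ∧ (∀ ξ, 0 < ξ → 0 < V ξ ∧ V ξ < z) ∧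
  Filter.Tendsto V Filter.atTop (nhds z)

/-- The translates `x ↦ u(x + h e₁)` converge as `h → +∞`, uniformly on `K` together with all
partial derivatives up to order two, to the limits `w`, `w1 i`, `w2 i j`. -/
def C2ConvOn {N : ℕ} (i0 : Fin N) (u : (Fin N → ℝ) → ℝ) (K : Set (Fin N → ℝ))
    (w : (Fin N → ℝ) → ℝ) (w1 : Fin N → (Fin N → ℝ) → ℝ)
    (w2 : Fin N → Fin N → (Fin N → ℝ) → ℝ) : Prop :=
  TendstoUniformlyOn (fun (h : ℝ) x => u (Function.update x i0 (x i0 + h))) w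
    Filter.atTop K ∧
  (∀ i, TendstoUniformlyOn (fun (h : ℝ) x => pd i u (Function.update x i0 (x i0 + h)))
      (w1 i) Filter.atTop K) ∧
  (∀ i j, TendstoUniformlyOn
      (fun (h : ℝ) x => pd i (pd j u) (Function.update x i0 (x i0 + h)))
      (w2 i j) Filter.atTop K)

/-- `F(z) = ∫₀^z f(σ) dσ`. -/
def Ff (f : ℝ → ℝ) (z : ℝ) : ℝ := ∫ σ in (0:ℝ)..z, f σ

/-- The set `Z_f = {z₀ ≥ 0 : f(z₀) = 0 and F(z) < F(z₀) for all z ∈ [0,z₀)}`. -/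
def Zf (f : ℝ → ℝ) : Set ℝ :=
  {z | 0 ≤ z ∧ f z = 0 ∧ ∀ w, 0 ≤ w → w < z → Ff f w < Ff f z}

/-- `(V, V')` belongs to `R_f`: a bounded nonnegative `C²` solution on `[0,∞)` of
`V'' + f(V) = 0` with `V(0) = 0`. -/
def InRf (f V V' : ℝ → ℝ) : Prop :=
  (∀ ξ ∈ Set.Ici (0:ℝ), HasDerivWithinAt V (V' ξ) (Set.Ici 0) ξ) ∧
  (∀ ξ ∈ Set.Ici (0:ℝ), HasDerivWithinAt V' (-(f (V ξ))) (Set.Ici 0) ξ) ∧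
  V 0 = 0 ∧ (∀ ξ, 0 ≤ ξ → 0 ≤ V ξ) ∧ (∃ C, ∀ ξ, 0 ≤ ξ → V ξ ≤ C)

/-! ### Second derivatives along lines -/

/-- `φ` is twice differentiable at `t`, with first derivative `p` and second derivative `q`. -/
def HasSecondDeriv (φ : ℝ → ℝ) (t p q : ℝ) : Prop :=
  ∃ φ' : ℝ → ℝ, (∀ᶠ s in nhds t, HasDerivAt φ (φ' s) s) ∧ HasDerivAt φ' q t ∧ φ' t = p

namespace HasSecondDeriv

variable {φ ψ : ℝ → ℝ} {t p q p₁ q₁ : ℝ}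

lemma of_forall {φ φ' : ℝ → ℝ} {t q : ℝ} (h : ∀ s, HasDerivAt φ (φ' s) s)
    (h' : HasDerivAt φ' q t) : HasSecondDeriv φ t (φ' t) q :=
  ⟨φ', Eventually.of_forall h, h', rfl⟩

lemma hasDerivAt (h : HasSecondDeriv φ t p q) : HasDerivAt φ p t := by
  obtain ⟨φ', h1, -, rfl⟩ := h
  exact h1.self_of_nhds

lemma deriv_eventuallyEq {φ' : ℝ → ℝ} (h : ∀ᶠ s in nhds t, HasDerivAt φ (φ' s) s) :
    deriv φ =ᶠ[nhds t] φ' := by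
  filter_upwards [h] with s hs using hs.deriv

lemma deriv_deriv (h : HasSecondDeriv φ t p q) : deriv (deriv φ) t = q := by
  obtain ⟨φ', h1, h2, -⟩ := h
  rw [(deriv_eventuallyEq h1).deriv_eq, h2.deriv]

lemma congr (h : HasSecondDeriv φ t p q) (e : ψ =ᶠ[nhds t] φ) : HasSecondDeriv ψ t p q := by
  obtain ⟨φ', h1, h2, h3⟩ := h
  refine ⟨φ', ?_, h2, h3⟩
  filter_upwards [h1, e.eventuallyEq_nhds] with s hs he using hs.congr_of_eventuallyEq he

lemma const (c t : ℝ) : HasSecondDeriv (fun _ => c) t 0 0 :=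
  of_forall (φ' := fun _ => 0) (fun s => hasDerivAt_const s c) (hasDerivAt_const t 0)

lemma add (h : HasSecondDeriv φ t p q) (h₁ : HasSecondDeriv ψ t p₁ q₁) :
    HasSecondDeriv (fun s => φ s + ψ s) t (p + p₁) (q + q₁) := by
  obtain ⟨φ', h1, h2, rfl⟩ := h
  obtain ⟨ψ', k1, k2, rfl⟩ := h₁
  refine ⟨fun s => φ' s + ψ' s, ?_, h2.add k2, rfl⟩
  filter_upwards [h1, k1] with s a b using a.add b

lemma const_mul (c : ℝ) (h : HasSecondDeriv φ t p q) :
    HasSecondDeriv (fun s => c * φ s) t (c * p) (c * q) := by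
  obtain ⟨φ', h1, h2, rfl⟩ := h
  refine ⟨fun s => c * φ' s, ?_, h2.const_mul c, rfl⟩
  filter_upwards [h1] with s a using a.const_mul c

lemma sub (h : HasSecondDeriv φ t p q) (h₁ : HasSecondDeriv ψ t p₁ q₁) :
    HasSecondDeriv (fun s => φ s - ψ s) t (p - p₁) (q - q₁) := by
  obtain ⟨φ', h1, h2, rfl⟩ := h
  obtain ⟨ψ', k1, k2, rfl⟩ := h₁
  refine ⟨fun s => φ' s - ψ' s, ?_, h2.sub k2, rfl⟩
  filter_upwards [h1, k1] with s a b using a.sub b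

lemma comp {T : ℝ → ℝ} {a b : ℝ} (hT : HasSecondDeriv T (φ t) a b)
    (h : HasSecondDeriv φ t p q) :
    HasSecondDeriv (fun s => T (φ s)) t (a * p) (b * p ^ 2 + a * q) := by
  have hφ := h.hasDerivAt
  obtain ⟨φ', h1, h2, rfl⟩ := h
  obtain ⟨T', k1, k2, rfl⟩ := hT
  refine ⟨fun s => T' (φ s) * φ' s, ?_, ?_, rfl⟩
  · filter_upwards [h1, hφ.continuousAt.eventually k1] with s a b using b.comp s a
  · have := (k2.comp t hφ).mul h2
    exact this.congr_deriv (by simp only [Function.comp]; ring)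

lemma comp_affine {a c : ℝ} (h : HasSecondDeriv φ (a * t + c) p q) :
    HasSecondDeriv (fun s => φ (a * s + c)) t (a * p) (a ^ 2 * q) := by
  have : HasSecondDeriv (fun s => a * s + c) t a 0 :=
    of_forall (φ' := fun _ => a)
      (fun s => by simpa using ((hasDerivAt_id s).const_mul a).add_const c) (hasDerivAt_const t a)
  convert HasSecondDeriv.comp (φ := fun s => a * s + c) h this using 1 <;> ring

lemma of_isLocalMax (h : HasSecondDeriv φ t p q) (hm : IsLocalMax φ t) : p = 0 ∧ q ≤ 0 := by
  have hp : p = 0 := hm.hasDerivAt_eq_zero h.hasDerivAt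
  refine ⟨hp, ?_⟩
  by_contra! hq
  have h1 : IsLocalMin φ t := by
    refine isLocalMin_of_deriv_deriv_pos ?_ ?_ h.hasDerivAt.continuousAt
    · rw [h.deriv_deriv]; exact hq
    · rw [h.hasDerivAt.deriv, hp]
  have h2 : φ =ᶠ[nhds t] fun _ => φ t := by
    filter_upwards [h1, hm] with s a b using le_antisymm b a
  have h3 := ((const (φ t) t).congr h2).deriv_deriv
  rw [h.deriv_deriv] at h3
  exact hq.ne' h3

lemma of_contDiffAt (h : ContDiffAt ℝ 2 φ t) :
    HasSecondDeriv φ t (deriv φ t) (deriv (deriv φ) t) := by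
  refine ⟨deriv φ, ?_, ?_, rfl⟩
  · have h1 : ContDiffAt ℝ 1 φ t := h.of_le (by norm_num)
    filter_upwards [h1.eventually (by norm_num)] with s hs
    exact (hs.differentiableAt (by norm_num)).hasDerivAt
  · have h1 : ContDiffAt ℝ 1 (deriv φ) t := by
      have := h.fderiv_right (m := 1) (by norm_num)
      have h2 := this.clm_apply (contDiffAt_const (c := (1:ℝ)))
      exact h2
    exact (h1.differentiableAt (by norm_num)).hasDerivAt

lemma quadratic (α β γ t : ℝ) :
    HasSecondDeriv (fun s => α + β * s + γ * s ^ 2) t (β + 2 * γ * t) (2 * γ) := by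
  refine of_forall (φ' := fun s => β + 2 * γ * s) (fun s => ?_) ?_
  · have := (((hasDerivAt_id s).const_mul β).const_add α).add (((hasDerivAt_id s).pow 2).const_mul γ)
    exact this.congr_deriv (by simp; ring)
  · simpa using ((hasDerivAt_id t).const_mul (2 * γ)).const_add β

lemma exp_affine (a c t : ℝ) :
    HasSecondDeriv (fun s => Real.exp (a * s + c)) t (a * Real.exp (a * t + c))
      (a ^ 2 * Real.exp (a * t + c)) :=
  comp_affine (of_forall (φ' := Real.exp) Real.hasDerivAt_exp (Real.hasDerivAt_exp _))

end HasSecondDeriv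

/-- `v` is twice differentiable at `x` along each coordinate line, with first and second pure
partial derivatives `p i` and `q i`. -/
def HasPureDerivs {N : ℕ} (v : (Fin N → ℝ) → ℝ) (x p q : Fin N → ℝ) : Prop :=
  ∀ i, HasSecondDeriv (fun t => v (Function.update x i t)) (x i) (p i) (q i)

namespace HasPureDerivs

variable {N : ℕ} {v w : (Fin N → ℝ) → ℝ} {x p q p₁ q₁ : Fin N → ℝ}

lemma sub (h : HasPureDerivs v x p q) (h₁ : HasPureDerivs w x p₁ q₁) :
    HasPureDerivs (fun y => v y - w y) x (p - p₁) (q - q₁) := fun i => (h i).sub (h₁ i)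

lemma const_mul (c : ℝ) (h : HasPureDerivs v x p q) :
    HasPureDerivs (fun y => c * v y) x (c • p) (c • q) := fun i => (h i).const_mul c

lemma comp {T : ℝ → ℝ} {a b : ℝ} (hT : HasSecondDeriv T (v x) a b) (h : HasPureDerivs v x p q) :
    HasPureDerivs (fun y => T (v y)) x (fun i => a * p i) (fun i => b * p i ^ 2 + a * q i) :=
  fun i => HasSecondDeriv.comp (by simpa using hT) (h i)

lemma congr_fun (h : HasPureDerivs v x p q) (e : ∀ y, w y = v y) : HasPureDerivs w x p q := by
  have : w = v := funext e
  rwa [this]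

lemma const (c : ℝ) (x : Fin N → ℝ) : HasPureDerivs (fun _ => c) x 0 0 :=
  fun i => HasSecondDeriv.const c (x i)

lemma coord {φ : ℝ → ℝ} {k : Fin N} {a b : ℝ} (h : HasSecondDeriv φ (x k) a b) :
    HasPureDerivs (fun y => φ (y k)) x (Pi.single k a) (Pi.single k b) := by
  intro i
  by_cases hik : k = i
  · subst hik; simpa using h
  · simpa [hik, Ne.symm hik, Function.update_of_ne hik, Pi.single_eq_of_ne (Ne.symm hik)] using
      HasSecondDeriv.const (φ (x k)) (x i)

lemma lap_eq (h : HasPureDerivs v x p q) : lap v x = ∑ i, q i := by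
  unfold lap pd
  refine Finset.sum_congr rfl fun i _ => ?_
  rw [← (h i).deriv_deriv]
  congr 1
  funext t
  simp

lemma of_isLocalMax (h : HasPureDerivs v x p q) (hm : IsLocalMax v x) :
    (∀ i, p i = 0) ∧ ∀ i, q i ≤ 0 := by
  have key : ∀ i, p i = 0 ∧ q i ≤ 0 := by
    intro i
    refine (h i).of_isLocalMax ?_
    have hc : ContinuousAt (fun t => Function.update x i t) (x i) := by fun_prop
    have : Tendsto (fun t => Function.update x i t) (nhds (x i)) (nhds x) := by
      simpa [ContinuousAt] using hc
    have := this.eventually hm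
    simpa [IsLocalMax, IsMaxFilter] using this
  exact ⟨fun i => (key i).1, fun i => (key i).2⟩

lemma of_contDiffAt (h : ContDiffAt ℝ 2 v x) :
    ∃ p q, HasPureDerivs v x p q ∧ ∑ i, q i = lap v x := by
  have : HasPureDerivs v x (fun i => deriv (fun t => v (Function.update x i t)) (x i))
      (fun i => deriv (deriv (fun t => v (Function.update x i t))) (x i)) := by
    intro i
    refine HasSecondDeriv.of_contDiffAt ?_
    refine ContDiffAt.comp (x i) (g := v) (by simpa using h) ?_
    exact (contDiff_update 2 x i).contDiffAt
  exact ⟨_, _, this, this.lap_eq.symm⟩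

/-- Affine change of variable in the coordinate `k`. -/
lemma comp_update {k : Fin N} {a c : ℝ} (ha : a ^ 2 = 1)
    (h : HasPureDerivs v (Function.update x k (a * x k + c)) p q) :
    HasPureDerivs (fun y => v (Function.update y k (a * y k + c))) x
      (Function.update p k (a * p k)) q := by
  intro i
  by_cases hik : i = k
  · subst hik
    have := h i
    simp only [Function.update_idem, Function.update_self] at this
    have := this.comp_affine
    simpa [ha] using this
  · have := h i
    simp only [Function.update_of_ne hik] at this ⊢
    refine this.congr (Eventually.of_forall fun t => ?_)
    simp only [Function.update_of_ne (Ne.symm hik)]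
    rw [Function.update_comm hik]

end HasPureDerivs

/-- The square of the Euclidean distance between `x` and `y`. -/
def sqDist {N : ℕ} (y x : Fin N → ℝ) : ℝ := ∑ i, (x i - y i) ^ 2

section sqDist

variable {N : ℕ}

lemma sqDist_nonneg (y x : Fin N → ℝ) : 0 ≤ sqDist y x :=
  Finset.sum_nonneg fun _ _ => sq_nonneg _

@[simp] lemma sqDist_self (y : Fin N → ℝ) : sqDist y y = 0 := by simp [sqDist]

lemma continuous_sqDist (y : Fin N → ℝ) : Continuous (sqDist y) := by
  unfold sqDist; fun_prop

lemma sq_coord_le_sqDist (y x : Fin N → ℝ) (i : Fin N) : (x i - y i) ^ 2 ≤ sqDist y x :=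
  Finset.single_le_sum (f := fun i => (x i - y i) ^ 2) (fun _ _ => sq_nonneg _)
    (Finset.mem_univ i)

lemma isCompact_sqDist_le (y : Fin N → ℝ) (R : ℝ) : IsCompact {x | sqDist y x ≤ R} := by
  refine Metric.isCompact_of_isClosed_isBounded
    (isClosed_le (continuous_sqDist y) continuous_const) ?_
  refine (Metric.isBounded_closedBall (x := y) (r := R + 1)).subset fun x hx => ?_
  have hR : 0 ≤ R := (sqDist_nonneg y x).trans hx
  rw [Metric.mem_closedBall, dist_pi_le_iff (by linarith)]
  intro i
  have h1 : (x i - y i) ^ 2 ≤ R := (sq_coord_le_sqDist y x i).trans hx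
  rw [Real.dist_eq]
  exact abs_le_of_sq_le_sq (by nlinarith) (by linarith)

lemma hasPureDerivs_sqDist (y x : Fin N → ℝ) :
    HasPureDerivs (sqDist y) x (fun i => 2 * (x i - y i)) (fun _ => 2) := by
  intro i
  have e : (fun t => sqDist y (Function.update x i t)) =
      fun t => (∑ j ∈ Finset.univ.erase i, (x j - y j) ^ 2 + y i ^ 2) + (-2 * y i) * t
        + 1 * t ^ 2 := by
    funext t
    unfold sqDist
    rw [← Finset.add_sum_erase _ _ (Finset.mem_univ i)]
    have : ∑ j ∈ Finset.univ.erase i, (Function.update x i t j - y j) ^ 2 =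
        ∑ j ∈ Finset.univ.erase i, (x j - y j) ^ 2 :=
      Finset.sum_congr rfl fun j hj => by
        rw [Function.update_of_ne (Finset.ne_of_mem_erase hj)]
    rw [this]
    simp only [Function.update_self]
    ring
  rw [e]
  convert HasSecondDeriv.quadratic _ _ _ _ using 1 <;> ring

end sqDist

/-- A bounded above continuous function on a closed set attains its maximum after subtraction
of a small multiple of `|x|²`. -/
lemma exists_penalized_max {N : ℕ} {S : Set (Fin N → ℝ)} (hS : IsClosed S)
    {g : (Fin N → ℝ) → ℝ} (hg : ContinuousOn g S) {B : ℝ} (hB : ∀ x ∈ S, g x ≤ B)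
    {x₀ : Fin N → ℝ} (hx₀ : x₀ ∈ S) {δ : ℝ} (hδ : 0 < δ) :
    ∃ x ∈ S, ∀ y ∈ S, g y - δ * sqDist 0 y ≤ g x - δ * sqDist 0 x := by
  set R := (B - (g x₀ - δ * sqDist 0 x₀)) / δ with hR
  have hRδ : δ * R = B - (g x₀ - δ * sqDist 0 x₀) := by rw [hR]; field_simp
  have hK : IsCompact (S ∩ {x | sqDist 0 x ≤ R}) := (isCompact_sqDist_le 0 R).inter_left hS
  have h0 : x₀ ∈ S ∩ {x | sqDist 0 x ≤ R} := by
    refine ⟨hx₀, ?_⟩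
    have := hB x₀ hx₀
    show sqDist 0 x₀ ≤ R
    nlinarith
  obtain ⟨x, hx, hmax⟩ := hK.exists_isMaxOn ⟨x₀, h0⟩
    (f := fun x => g x - δ * sqDist 0 x)
    ((hg.mono inter_subset_left).sub ((continuous_sqDist 0).continuousOn.const_mul δ |>.mono
      (subset_univ _)))
  refine ⟨x, hx.1, fun y hy => ?_⟩
  by_cases hyR : sqDist 0 y ≤ R
  · exact hmax ⟨hy, hyR⟩
  · have h1 := hB y hy
    have h2 : g x₀ - δ * sqDist 0 x₀ ≤ g x - δ * sqDist 0 x := hmax h0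
    push Not at hyR
    nlinarith

/-- Weak maximum principle in a slab. -/
lemma le_zero_of_lap_pos_slab {N : ℕ} {k : Fin N} {a b ε B : ℝ} {g : (Fin N → ℝ) → ℝ}
    (hε : 0 < ε) (hg : ContinuousOn g {x | x k ∈ Icc a b})
    (hB : ∀ x : Fin N → ℝ, x k ∈ Icc a b → g x ≤ B)
    (ha : ∀ x : Fin N → ℝ, x k = a → g x ≤ 0) (hb : ∀ x : Fin N → ℝ, x k = b → g x ≤ 0)
    (hlap : ∀ x : Fin N → ℝ, x k ∈ Ioo a b → 0 < g x →
      ∃ p q, HasPureDerivs g x p q ∧ ε ≤ ∑ i, q i)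
    {x : Fin N → ℝ} (hx : x k ∈ Icc a b) : g x ≤ 0 := by
  by_contra! hpos
  have hN : (0:ℝ) ≤ N := Nat.cast_nonneg N
  have hsq := sqDist_nonneg 0 x
  obtain ⟨δ, hδ, h1, h2⟩ : ∃ δ > 0, δ * sqDist 0 x < g x ∧ δ * (2 * N) < ε := by
    refine ⟨min (g x / (sqDist 0 x + 1)) (ε / (2 * N + 1)) / 2, by positivity, ?_, ?_⟩
    · have : min (g x / (sqDist 0 x + 1)) (ε / (2 * N + 1)) ≤ g x / (sqDist 0 x + 1) :=
        min_le_left _ _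
      rw [le_div_iff₀ (by positivity)] at this
      have h0 : 0 < min (g x / (sqDist 0 x + 1)) (ε / (2 * N + 1)) := by positivity
      nlinarith
    · have : min (g x / (sqDist 0 x + 1)) (ε / (2 * N + 1)) ≤ ε / (2 * N + 1) :=
        min_le_right _ _
      rw [le_div_iff₀ (by positivity)] at this
      have h0 : 0 < min (g x / (sqDist 0 x + 1)) (ε / (2 * N + 1)) := by positivity
      nlinarith
  have hS : IsClosed {x : Fin N → ℝ | x k ∈ Icc a b} := isClosed_Icc.preimage (continuous_apply k)
  obtain ⟨y, hy, hmax⟩ := exists_penalized_max hS hg hB hx hδ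
  have hgy : 0 < g y := by
    have := hmax x hx
    nlinarith [sqDist_nonneg 0 y]
  have hyI : y k ∈ Ioo a b := by
    refine ⟨lt_of_le_of_ne hy.1 fun h => ?_, lt_of_le_of_ne hy.2 fun h => ?_⟩
    · exact (ha y h.symm).not_gt hgy
    · exact (hb y h).not_gt hgy
  obtain ⟨p, q, hpq, hq⟩ := hlap y hyI hgy
  have hloc : IsLocalMax (fun z => g z - δ * sqDist 0 z) y := by
    have : {x : Fin N → ℝ | x k ∈ Ioo a b} ∈ nhds y :=
      (isOpen_Ioo.preimage (continuous_apply k)).mem_nhds hyI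
    filter_upwards [this] with z hz using hmax z ⟨hz.1.le, hz.2.le⟩
  have := ((hpq.sub ((hasPureDerivs_sqDist 0 y).const_mul δ)).of_isLocalMax hloc).2
  have h3 : ∑ i, q i ≤ ∑ _i : Fin N, δ * 2 := Finset.sum_le_sum fun i _ => by
    have := this i
    simp at this
    linarith
  simp at h3
  linarith

/-! ### Comparison in slabs -/

section Slab

variable {N : ℕ} {k : Fin N} {w : (Fin N → ℝ) → ℝ} {a b : ℝ}

/-- Maximum principle in a narrow slab. -/
lemma nonneg_of_narrow_slab {L m : ℝ} (hab : a < b) (hL : 0 ≤ L) (hLd : L * (b - a) ^ 2 ≤ 2)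
    (hw : ContinuousOn w {x | x k ∈ Icc a b})
    (hm : ∀ x : Fin N → ℝ, x k ∈ Icc a b → -m ≤ w x)
    (ha : ∀ x : Fin N → ℝ, x k = a → 0 ≤ w x) (hb : ∀ x : Fin N → ℝ, x k = b → 0 ≤ w x)
    (hlap : ∀ x : Fin N → ℝ, x k ∈ Ioo a b → w x < 0 →
      ∃ p q, HasPureDerivs w x p q ∧ ∑ i, q i ≤ -(L * w x))
    {x : Fin N → ℝ} (hx : x k ∈ Icc a b) : 0 ≤ w x := by
  have step : ∀ m > 0, (∀ x : Fin N → ℝ, x k ∈ Icc a b → -m ≤ w x) →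
      ∀ x : Fin N → ℝ, x k ∈ Icc a b → -(m / 2) ≤ w x := by
    intro m hm0 hm x hx
    have hd : 0 < (b - a) ^ 2 := by have := sub_pos.2 hab; positivity
    set κ := m / (b - a) ^ 2 with hκ
    have hκd : κ * (b - a) ^ 2 = m := div_mul_cancel₀ _ hd.ne'
    have hκ0 : 0 < κ := by positivity
    have hquad : Continuous fun x : Fin N → ℝ =>
        -(L * m / 2 + κ) * (x k - a) * (b - x k) := by fun_prop
    have hb0 : ∀ x : Fin N → ℝ, x k ∈ Icc a b → 0 ≤ (x k - a) * (b - x k) := fun x hx =>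
      mul_nonneg (sub_nonneg.2 hx.1) (sub_nonneg.2 hx.2)
    have key := le_zero_of_lap_pos_slab (k := k) (a := a) (b := b) (ε := 2 * κ) (B := m)
      (g := fun x => (-(L * m / 2 + κ) * (x k - a) * (b - x k)) - w x) (by positivity)
      (hquad.continuousOn.sub hw) ?_ ?_ ?_ ?_ hx
    · have h4 : (x k - a) * (b - x k) ≤ (b - a) ^ 2 / 4 := by
        nlinarith [sq_nonneg ((x k - a) - (b - x k))]
      have h5 : (L * m / 2 + κ) * ((x k - a) * (b - x k)) ≤
          (L * m / 2 + κ) * ((b - a) ^ 2 / 4) := by gcongr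
      have h6 : (L * m / 2 + κ) * ((b - a) ^ 2 / 4) ≤ m / 2 := by nlinarith
      linarith
    · intro x hx
      have := hm x hx
      have h7 := hb0 x hx
      have : 0 ≤ (L * m / 2 + κ) * ((x k - a) * (b - x k)) := by positivity
      linarith
    · intro x hx; have := ha x hx; simp [hx, this]
    · intro x hx; have := hb x hx; simp [hx, this]
    · intro x hx hg
      have h7 := hb0 x ⟨hx.1.le, hx.2.le⟩
      have h8 : 0 ≤ (L * m / 2 + κ) * ((x k - a) * (b - x k)) := by positivity
      have hneg : w x < 0 := by linarith
      obtain ⟨p, q, hpq, hq⟩ := hlap x hx hneg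
      have h9 := HasPureDerivs.coord (k := k) (x := x) (HasSecondDeriv.quadratic
        ((L * m / 2 + κ) * a * b) (-(L * m / 2 + κ) * (a + b)) (L * m / 2 + κ) (x k))
      refine ⟨_, _, ((h9.sub hpq : HasPureDerivs _ _ _ _)).congr_fun ?_, ?_⟩
      · intro y; ring
      · have h10 := hm x ⟨hx.1.le, hx.2.le⟩
        simp only [Pi.sub_apply, Finset.sum_sub_distrib, Finset.sum_pi_single', Finset.mem_univ,
          if_true]
        nlinarith
  have hpow : ∀ n : ℕ, ∀ x : Fin N → ℝ, x k ∈ Icc a b → -((|m| + 1) / 2 ^ n) ≤ w x := by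
    intro n
    induction n with
    | zero => intro x hx; have := hm x hx; have := le_abs_self m; simp; linarith
    | succ n ih =>
      intro x hx
      have := step _ (by positivity) ih x hx
      rw [pow_succ, ← div_div]; exact this
  have hlim : Tendsto (fun n : ℕ => -((|m| + 1) / 2 ^ n)) atTop (nhds (-0)) := by
    refine Tendsto.neg ?_
    exact tendsto_const_nhds.div_atTop (tendsto_pow_atTop_atTop_of_one_lt one_lt_two)
  rw [neg_zero] at hlim
  exact le_of_tendsto' hlim fun n => hpow n x hx

/-- Quantitative positivity of a nonnegative function with `Δw ≤ K²w` in a slab. -/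
lemma barrier_le_of_lap_le {K η : ℝ} (hK : 0 < K) (hη : 0 < η) (hb0 : 0 < b)
    (hw : ContinuousOn w {x | x k ∈ Icc 0 b})
    (h0 : ∀ x : Fin N → ℝ, x k ∈ Icc 0 b → 0 ≤ w x)
    (hη' : ∀ x : Fin N → ℝ, x k = 0 → η ≤ w x)
    (hlap : ∀ x : Fin N → ℝ, x k ∈ Ioo 0 b →
      ∃ p q, HasPureDerivs w x p q ∧ ∑ i, q i ≤ K ^ 2 * w x)
    {x : Fin N → ℝ} (hx : x k ∈ Icc 0 b) :
    η * Real.exp (-(K * b)) * (Real.exp (K * (b - x k)) - 1) ≤ w x := by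
  set ρ := η * Real.exp (-(K * b)) with hρ
  have hρ0 : 0 < ρ := by positivity
  have hρe : ρ * Real.exp (K * b) = η := by
    rw [hρ, mul_assoc, ← Real.exp_add]; simp
  have key := le_zero_of_lap_pos_slab (k := k) (a := 0) (b := b) (ε := K ^ 2 * ρ) (B := η)
    (g := fun x => (-ρ + ρ * Real.exp (-K * x k + K * b)) - w x) (by positivity)
    (ContinuousOn.sub (Continuous.continuousOn (by fun_prop)) hw) ?_ ?_ ?_ ?_ hx
  · have : K * (b - x k) = -K * x k + K * b := by ring
    rw [this]
    linarith
  · intro x hx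
    have h1 : Real.exp (-K * x k + K * b) ≤ Real.exp (K * b) := by
      apply Real.exp_le_exp.2; nlinarith [hx.1]
    have := h0 x hx
    nlinarith
  · intro x hx
    have := hη' x hx
    simp only [hx, mul_zero, zero_add]
    linarith
  · intro x hx
    have := h0 x ⟨by rw [hx]; exact hb0.le, hx.le⟩
    have h2 : -K * b + K * b = 0 := by ring
    simp only [hx, h2, Real.exp_zero]
    linarith
  · intro x hx hg
    obtain ⟨p, q, hpq, hq⟩ := hlap x hx
    have h9 := HasPureDerivs.coord (k := k) (x := x) ((HasSecondDeriv.const (-ρ) (x k)).add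
      ((HasSecondDeriv.exp_affine (-K) (K * b) (x k)).const_mul ρ))
    refine ⟨_, _, h9.sub hpq, ?_⟩
    simp only [Pi.sub_apply, Finset.sum_sub_distrib, Finset.sum_pi_single', Finset.mem_univ,
      if_true]
    nlinarith [sq_pos_of_pos hK]

end Slab

/-! ### Nonnegative bounded solutions in the half-space -/

/-- `u` is a solution, with values in `[0, M]`, of `Δu + f(u) = 0` in the half-space `x k > 0`,
vanishing on the boundary. -/
structure IsHalfSpaceSol {N : ℕ} (k : Fin N) (f : ℝ → ℝ) (M : ℝ) (u : (Fin N → ℝ) → ℝ) :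
    Prop where
  pde : ∀ x : Fin N → ℝ, 0 < x k → ∃ p q, HasPureDerivs u x p q ∧ ∑ i, q i = -f (u x)
  cont : ContinuousOn u {x | 0 ≤ x k}
  nonneg : ∀ x : Fin N → ℝ, 0 ≤ x k → 0 ≤ u x
  le : ∀ x : Fin N → ℝ, 0 ≤ x k → u x ≤ M
  dir : ∀ x : Fin N → ℝ, x k = 0 → u x = 0

namespace IsHalfSpaceSol

variable {N : ℕ} {k : Fin N} {f : ℝ → ℝ} {M : ℝ} {u : (Fin N → ℝ) → ℝ}

/-- Comparison with a one-dimensional quadratic subsolution in a slab. -/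
lemma quadratic_le (hu : IsHalfSpaceSol k f M u) {a b α β γ ε : ℝ} (ha0 : 0 ≤ a) (hε : 0 < ε)
    (ha : ∀ x : Fin N → ℝ, x k = a → α + β * a + γ * a ^ 2 ≤ u x)
    (hb : ∀ x : Fin N → ℝ, x k = b → α + β * b + γ * b ^ 2 ≤ u x)
    (h_int : ∀ x : Fin N → ℝ, x k ∈ Ioo a b → u x < α + β * x k + γ * x k ^ 2 →
      ε ≤ 2 * γ + f (u x))
    {x : Fin N → ℝ} (hx : x k ∈ Icc a b) : α + β * x k + γ * x k ^ 2 ≤ u x := by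
  obtain ⟨B, hB⟩ : ∃ B, ∀ t ∈ Icc a b, α + β * t + γ * t ^ 2 ≤ B := by
    obtain ⟨B, hB⟩ := (isCompact_Icc (a := a) (b := b)).bddAbove_image
      (f := fun t => α + β * t + γ * t ^ 2) (by fun_prop)
    exact ⟨B, fun t ht => hB (mem_image_of_mem _ ht)⟩
  have key := le_zero_of_lap_pos_slab (k := k) (a := a) (b := b) (ε := ε) (B := B)
    (g := fun x => (α + β * x k + γ * x k ^ 2) - u x) hε
    (ContinuousOn.sub (Continuous.continuousOn (by fun_prop))
      (hu.cont.mono fun x hx => ha0.trans hx.1)) ?_ ?_ ?_ ?_ hx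
  · linarith
  · intro x hx
    have := hu.nonneg x (ha0.trans hx.1)
    have := hB _ hx
    linarith
  · intro x hx; have := ha x hx; rw [hx]; linarith
  · intro x hx; have := hb x hx; rw [hx]; linarith
  · intro x hx hg
    obtain ⟨p, q, hpq, hq⟩ := hu.pde x (ha0.trans_lt hx.1)
    have h9 := HasPureDerivs.coord (k := k) (x := x) (HasSecondDeriv.quadratic α β γ (x k))
    refine ⟨_, _, h9.sub hpq, ?_⟩
    have := h_int x hx (by linarith)
    simp only [Pi.sub_apply, Finset.sum_sub_distrib, Finset.sum_pi_single', Finset.mem_univ,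
      if_true]
    linarith

/-- Lower bounds at a given height propagate upwards. -/
lemma le_of_le_at_height (hu : IsHalfSpaceSol k f M u) (hf : ∀ s, 0 ≤ s → 0 ≤ f s) {a c : ℝ}
    (ha0 : 0 ≤ a) (hc : 0 < c) (ha : ∀ x : Fin N → ℝ, x k = a → c ≤ u x)
    {x : Fin N → ℝ} (hx : a ≤ x k) : c ≤ u x := by
  have key : ∀ D > x k - a, c * (1 - (x k - a) / D) ^ 2 ≤ u x := by
    intro D hD
    have hD0 : 0 < D := by linarith
    have e : ∀ t, c * (1 - (t - a) / D) ^ 2 =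
        c * (1 + a / D) ^ 2 + (-2 * c * (1 + a / D) / D) * t + (c / D ^ 2) * t ^ 2 := by
      intro t; field_simp; ring
    rw [e]
    refine hu.quadratic_le (a := a) (b := a + D) (ε := 2 * (c / D ^ 2)) ha0 (by positivity)
      ?_ ?_ ?_ ⟨hx, by linarith⟩
    · intro y hy; rw [← e]; simpa using ha y hy
    · intro y hy
      rw [← e]
      have := hu.nonneg y (by rw [hy]; linarith)
      simpa [hD0.ne'] using this
    · intro y hy _
      have := hf _ (hu.nonneg y (by linarith [hy.1]))
      linarith
  have hlim : Tendsto (fun D : ℝ => c * (1 - (x k - a) / D) ^ 2) atTop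
      (nhds (c * (1 - 0) ^ 2)) :=
    ((tendsto_const_nhds.sub (tendsto_const_nhds.div_atTop tendsto_id)).pow 2).const_mul c
  have := le_of_tendsto hlim ((eventually_gt_atTop (x k - a)).mono key)
  simpa using this

/-- The set of asymptotic lower bounds of `u` far from the boundary. -/
def farLowerBounds (k : Fin N) (u : (Fin N → ℝ) → ℝ) : Set ℝ :=
  {c | ∃ t, 0 ≤ t ∧ ∀ x : Fin N → ℝ, t ≤ x k → c ≤ u x}

/-- The lower limit of `u` far from the boundary. -/
def farInf (k : Fin N) (u : (Fin N → ℝ) → ℝ) : ℝ := sSup (farLowerBounds k u)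

lemma zero_mem (hu : IsHalfSpaceSol k f M u) : (0:ℝ) ∈ farLowerBounds k u :=
  ⟨0, le_rfl, hu.nonneg⟩

lemma le_of_mem_farLowerBounds (hu : IsHalfSpaceSol k f M u) {c : ℝ}
    (hc : c ∈ farLowerBounds k u) : c ≤ M := by
  obtain ⟨t, ht, h⟩ := hc
  exact (h (fun _ => t) le_rfl).trans (hu.le _ ht)

lemma le_farInf (hu : IsHalfSpaceSol k f M u) {c : ℝ} (hc : c ∈ farLowerBounds k u) :
    c ≤ farInf k u := le_csSup ⟨M, fun _ h => hu.le_of_mem_farLowerBounds h⟩ hc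

lemma farInf_nonneg (hu : IsHalfSpaceSol k f M u) : 0 ≤ farInf k u := hu.le_farInf hu.zero_mem

lemma farInf_le (hu : IsHalfSpaceSol k f M u) : farInf k u ≤ M :=
  csSup_le ⟨0, hu.zero_mem⟩ fun _ h => hu.le_of_mem_farLowerBounds h

lemma exists_height (hu : IsHalfSpaceSol k f M u) {c : ℝ} (hc : c < farInf k u) :
    ∃ t, 0 ≤ t ∧ ∀ x : Fin N → ℝ, t ≤ x k → c ≤ u x := by
  obtain ⟨d, ⟨t, ht, h⟩, hd⟩ := exists_lt_of_lt_csSup ⟨0, hu.zero_mem⟩ hc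
  exact ⟨t, ht, fun x hx => hd.le.trans (h x hx)⟩

/-- `f` vanishes at the lower limit of `u`. -/
lemma apply_farInf_eq_zero (hu : IsHalfSpaceSol k f M u) (hf : ∀ s, 0 ≤ s → 0 ≤ f s)
    (hfc : ContinuousOn f (Ici 0)) : f (farInf k u) = 0 := by
  set z := farInf k u with hz
  have hz0 : 0 ≤ z := hu.farInf_nonneg
  by_contra hne
  have hpos : 0 < f z := lt_of_le_of_ne (hf z hz0) (Ne.symm hne)
  obtain ⟨r, hr, hfr⟩ : ∃ r > 0, ∀ s, 0 ≤ s → |s - z| < r → f z / 2 < f s := by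
    have := (hfc z hz0).eventually (lt_mem_nhds (half_lt_self hpos))
    rw [eventually_nhdsWithin_iff, Metric.eventually_nhds_iff] at this
    obtain ⟨r, hr, h⟩ := this
    exact ⟨r, hr, fun s hs hd => h (by rwa [Real.dist_eq]) hs⟩
  set r' := r / 2 with hr'
  have hr'0 : 0 < r' := by positivity
  obtain ⟨t, ht, hlow⟩ := hu.exists_height (c := z - r' / 2) (by linarith)
  set R := Real.sqrt (8 * r' / f z) with hR
  have hR2 : R ^ 2 = 8 * r' / f z := Real.sq_sqrt (by positivity)
  have hR0 : 0 < R := Real.sqrt_pos.2 (by positivity)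
  have hR3 : f z / 8 * R ^ 2 = r' := by rw [hR2]; field_simp
  have hmem : z - r' / 2 + r' ∈ farLowerBounds k u := by
    refine ⟨t + R, by positivity, fun x hx => ?_⟩
    set a := x k - R with ha
    have e : ∀ s, z - r' / 2 + f z / 8 * ((s - a) * (a + 2 * R - s)) =
        (z - r' / 2 - f z / 8 * (a * (a + 2 * R))) + (f z / 8 * (2 * a + 2 * R)) * s +
        (-(f z / 8)) * s ^ 2 := by intro s; ring
    have h1 : ∀ y : Fin N → ℝ, a ≤ y k → z - r' / 2 ≤ u y := fun y hy => hlow y (by linarith)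
    have h2 : ∀ s, f z / 8 * ((s - a) * (a + 2 * R - s)) ≤ r' := by
      intro s
      have : (s - a) * (a + 2 * R - s) ≤ R ^ 2 := by nlinarith [sq_nonneg (s - a - R)]
      rw [← hR3]; gcongr
    have := hu.quadratic_le (a := a) (b := a + 2 * R) (x := x) (ε := f z / 4) (by linarith)
      (by positivity)
      (α := z - r' / 2 - f z / 8 * (a * (a + 2 * R))) (β := f z / 8 * (2 * a + 2 * R))
      (γ := -(f z / 8)) ?_ ?_ ?_ ⟨by linarith, by linarith⟩
    · rw [← e] at this
      have h3 : x k - a = R := by rw [ha]; ring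
      have h4 : a + 2 * R - x k = R := by rw [ha]; ring
      rw [h3, h4, ← sq, hR3] at this
      exact this
    · intro y hy; rw [← e]; simpa using h1 y hy.ge
    · intro y hy; rw [← e]; simpa using h1 y (by linarith)
    · intro y hy hlt
      rw [← e] at hlt
      have h3 := h1 y hy.1.le
      have h4 := h2 (y k)
      have h5 := hfr (u y) (hu.nonneg y (by linarith [hy.1])) (by rw [abs_lt]; constructor <;> linarith)
      linarith
  have := hu.le_farInf hmem
  linarith

/-- If the lower limit of `u` is positive, then `u` is bounded from below away from the
boundary. -/
lemma exists_pos_le (hu : IsHalfSpaceSol k f M u) (hf : ∀ s, 0 ≤ s → 0 ≤ f s)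
    (hz : 0 < farInf k u) {t : ℝ} (ht : 0 < t) :
    ∃ η > 0, ∀ x : Fin N → ℝ, t ≤ x k → η ≤ u x := by
  obtain ⟨T, hT0, hT⟩ := hu.exists_height (half_lt_self hz)
  set c := farInf k u / 2 with hc
  have hc0 : 0 < c := by positivity
  set S := T + t with hS
  have hS0 : 0 < S := by positivity
  refine ⟨c / S ^ 2 * t ^ 2, by positivity, fun x hx => ?_⟩
  by_cases hxS : x k ≤ S
  · have := hu.quadratic_le (a := 0) (b := S) (α := 0) (β := 0) (γ := c / S ^ 2)
      (ε := 2 * (c / S ^ 2)) le_rfl (by positivity) ?_ ?_ ?_ (x := x) ⟨by linarith, hxS⟩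
    · refine le_trans ?_ this
      simp only [zero_mul, zero_add]
      gcongr
    · intro y hy; simpa using hu.nonneg y hy.ge
    · intro y hy
      have := hT y (by linarith)
      have e : c / S ^ 2 * S ^ 2 = c := by field_simp
      linarith
    · intro y hy _
      have := hf _ (hu.nonneg y hy.1.le)
      linarith
  · push Not at hxS
    refine le_trans ?_ (hT x (by linarith))
    have : c / S ^ 2 * t ^ 2 ≤ c / S ^ 2 * S ^ 2 := by gcongr; linarith
    have e : c / S ^ 2 * S ^ 2 = c := by field_simp
    linarith

end IsHalfSpaceSol

/-! ### Monotonicity by moving planes -/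

lemma continuousOn_comp_update {N : ℕ} {k : Fin N} {u : (Fin N → ℝ) → ℝ} {a c : ℝ}
    {S : Set (Fin N → ℝ)} (hu : ContinuousOn u {x | 0 ≤ x k}) (hS : ∀ x ∈ S, 0 ≤ a * x k + c) :
    ContinuousOn (fun x => u (Function.update x k (a * x k + c))) S := by
  refine hu.comp (Continuous.continuousOn (by fun_prop)) fun x hx => ?_
  simpa using hS x hx

namespace IsHalfSpaceSol

variable {N : ℕ} {k : Fin N} {f : ℝ → ℝ} {M L : ℝ} {u : (Fin N → ℝ) → ℝ}

/-- One-sided Lipschitz bound in the direction `k`, away from the boundary. -/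
lemma sub_le_of_reflect (hu : IsHalfSpaceSol k f M u) (hf : ∀ s, 0 ≤ s → 0 ≤ f s) {K d : ℝ}
    (hK : ∀ s ∈ Icc 0 M, f s ≤ K) (hd : 0 < d) {c : ℝ} (hc : d ≤ c) {x : Fin N → ℝ}
    (hx : x k ∈ Icc 0 d) :
    u (Function.update x k (-1 * x k + c)) - u (Function.update x k (1 * x k + c)) ≤
      (M / d + (K + 1) / 2 * d) * x k := by
  have hM : 0 ≤ M := (hu.nonneg 0 (by simp)).trans (hu.le 0 (by simp))
  have hK0 : 0 ≤ K := (hf 0 le_rfl).trans (hK 0 ⟨le_rfl, hM⟩)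
  have key := le_zero_of_lap_pos_slab (k := k) (a := 0) (b := d) (ε := 1) (B := M)
    (g := fun x => (u (Function.update x k (-1 * x k + c)) -
      u (Function.update x k (1 * x k + c))) -
      (0 + (M / d + (K + 1) / 2 * d) * x k + (-((K + 1) / 2)) * x k ^ 2)) one_pos
    ?_ ?_ ?_ ?_ ?_ hx
  · nlinarith [sq_nonneg (x k)]
  · refine ContinuousOn.sub (ContinuousOn.sub ?_ ?_) (Continuous.continuousOn (by fun_prop))
    · exact continuousOn_comp_update hu.cont fun y hy => by linarith [hy.2]
    · exact continuousOn_comp_update hu.cont fun y hy => by linarith [hy.1]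
  · intro y hy
    have h1 := hu.le (Function.update y k (-1 * y k + c)) (by simp; linarith [hy.2])
    have h2 := hu.nonneg (Function.update y k (1 * y k + c)) (by simp; linarith [hy.1])
    have h3 : 0 ≤ M / d * y k := mul_nonneg (by positivity) hy.1
    have h4 : 0 ≤ (K + 1) / 2 * (y k * (d - y k)) :=
      mul_nonneg (by positivity) (mul_nonneg hy.1 (by linarith [hy.2]))
    nlinarith
  · intro y hy
    simp [hy]
  · intro y hy
    have h1 := hu.le (Function.update y k (-1 * y k + c)) (by simp; linarith)
    have h2 := hu.nonneg (Function.update y k (1 * y k + c)) (by simp; linarith)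
    have h3 : M / d * d = M := by field_simp
    rw [hy] at *
    nlinarith
  · intro y hy _
    have c1 : 0 < Function.update y k (-1 * y k + c) k := by simp; linarith [hy.2]
    have c2 : 0 < Function.update y k (1 * y k + c) k := by simp; linarith [hy.1]
    obtain ⟨p, q, hpq, hq⟩ := hu.pde _ c1
    obtain ⟨p', q', hpq', hq'⟩ := hu.pde _ c2
    have h9 := HasPureDerivs.coord (k := k) (x := y)
      (HasSecondDeriv.quadratic 0 (M / d + (K + 1) / 2 * d) (-((K + 1) / 2)) (y k))
    refine ⟨_, _, ((HasPureDerivs.comp_update (by norm_num) hpq).sub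
      (HasPureDerivs.comp_update (by norm_num) hpq')).sub h9, ?_⟩
    simp only [Pi.sub_apply, Finset.sum_sub_distrib, Finset.sum_pi_single', Finset.mem_univ,
      if_true]
    have h1 := hK _ ⟨hu.nonneg _ c1.le, hu.le _ c1.le⟩
    have h2 := hf _ (hu.nonneg _ c2.le)
    linarith

/-- The inequality between `u` and its reflection across the hyperplane `x k = l`. -/
def ReflectLE (k : Fin N) (u : (Fin N → ℝ) → ℝ) (l : ℝ) : Prop :=
  ∀ x : Fin N → ℝ, x k ∈ Icc 0 l → 0 ≤ u (Function.update x k (-1 * x k + 2 * l)) - u x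

/-- The Laplacian of the difference between a reflection of `u` and `u`. -/
lemma reflect_pde (hu : IsHalfSpaceSol k f M u) {l : ℝ} {x : Fin N → ℝ} (hx : x k ∈ Ioo 0 l) :
    ∃ p q, HasPureDerivs (fun x => u (Function.update x k (-1 * x k + 2 * l)) - u x) x p q ∧
      ∑ i, q i = f (u x) - f (u (Function.update x k (-1 * x k + 2 * l))) := by
  have c1 : 0 < Function.update x k (-1 * x k + 2 * l) k := by simp; linarith [hx.2, hx.1]
  obtain ⟨p, q, hpq, hq⟩ := hu.pde _ c1
  obtain ⟨p', q', hpq', hq'⟩ := hu.pde _ hx.1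
  refine ⟨_, _, (HasPureDerivs.comp_update (by norm_num) hpq).sub hpq', ?_⟩
  simp only [Pi.sub_apply, Finset.sum_sub_distrib]
  linarith

lemma reflect_eq_zero {l : ℝ} {x : Fin N → ℝ} (hx : x k = l) :
    u (Function.update x k (-1 * x k + 2 * l)) - u x = 0 := by
  have : -1 * x k + 2 * l = x k := by rw [hx]; ring
  rw [this, Function.update_eq_self, sub_self]

lemma reflect_continuousOn (hu : IsHalfSpaceSol k f M u) {a b l : ℝ} (ha : 0 ≤ a) (hb : b ≤ l) :
    ContinuousOn (fun x => u (Function.update x k (-1 * x k + 2 * l)) - u x)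
      {x | x k ∈ Icc a b} :=
  (continuousOn_comp_update hu.cont fun y hy => by linarith [hy.2, hy.1]).sub
    (hu.cont.mono fun y hy => ha.trans hy.1)

lemma reflect_nonneg_of_narrow (hu : IsHalfSpaceSol k f M u) (hL0 : 0 ≤ L)
    (hL : ∀ s ∈ Icc 0 M, ∀ t ∈ Icc 0 M, |f s - f t| ≤ L * |s - t|) {a l : ℝ} (ha : 0 ≤ a)
    (hal : a < l) (hLd : L * (l - a) ^ 2 ≤ 2)
    (hwa : ∀ x : Fin N → ℝ, x k = a → 0 ≤ u (Function.update x k (-1 * x k + 2 * l)) - u x)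
    {x : Fin N → ℝ} (hx : x k ∈ Icc a l) :
    0 ≤ u (Function.update x k (-1 * x k + 2 * l)) - u x := by
  refine nonneg_of_narrow_slab (k := k) (a := a) (b := l) (m := M) (L := L)
    (w := fun x => u (Function.update x k (-1 * x k + 2 * l)) - u x) hal hL0 hLd
    (hu.reflect_continuousOn ha le_rfl) ?_ hwa (fun y hy => (reflect_eq_zero hy).ge) ?_ hx
  · intro y hy
    have h1 := hu.le y (ha.trans hy.1)
    have h2 := hu.nonneg (Function.update y k (-1 * y k + 2 * l))
      (by simp; linarith [hy.1, hy.2])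
    linarith
  · intro y hy hneg
    have hy0 : 0 ≤ y k := ha.trans hy.1.le
    have c1 : 0 ≤ Function.update y k (-1 * y k + 2 * l) k := by simp; linarith [hy.2]
    obtain ⟨p, q, hpq, hq⟩ := hu.reflect_pde (l := l) (x := y) ⟨ha.trans_lt hy.1, hy.2⟩
    refine ⟨p, q, hpq, ?_⟩
    have h3 := hL _ ⟨hu.nonneg _ hy0, hu.le _ hy0⟩ _ ⟨hu.nonneg _ c1, hu.le _ c1⟩
    rw [abs_of_pos (a := u y - _) (by linarith)] at h3
    have := le_abs_self (f (u y) - f (u (Function.update y k (-1 * y k + 2 * l))))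
    rw [hq]
    linarith

/-- The set of good reflection heights is uniformly open to the right. -/
lemma reflectLE_step (hu : IsHalfSpaceSol k f M u) (hf : ∀ s, 0 ≤ s → 0 ≤ f s) (hL0 : 0 ≤ L)
    (hL : ∀ s ∈ Icc 0 M, ∀ t ∈ Icc 0 M, |f s - f t| ≤ L * |s - t|)
    (hz : 0 < farInf k u) {d : ℝ} (hd : 0 < d) (hLd : L * (2 * d) ^ 2 ≤ 2) (B : ℝ) :
    ∃ τ > 0, ∀ l ∈ Icc (2 * d) B, ReflectLE k u l → ∀ h ∈ Icc 0 τ, ReflectLE k u (l + h) := by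
  obtain ⟨η, hη, hlow⟩ := hu.exists_pos_le hf hz hd
  have hM : 0 ≤ M := (hu.nonneg 0 (by simp)).trans (hu.le 0 (by simp))
  obtain ⟨K, hK0, hKL⟩ : ∃ K > 0, L ≤ K ^ 2 := ⟨L + 1, by positivity, by nlinarith⟩
  set F := f 0 + L * M with hF
  have hF0 : 0 ≤ F := add_nonneg (hf 0 le_rfl) (by positivity)
  have hfF : ∀ s ∈ Icc 0 M, f s ≤ F := by
    intro s hs
    have h1 := hL s hs 0 ⟨le_rfl, hM⟩
    have h2 := le_abs_self (f s - f 0)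
    rw [sub_zero, abs_of_nonneg hs.1] at h1
    have h3 : L * s ≤ L * M := by gcongr; exact hs.2
    linarith
  set C := M / d + (F + 1) / 2 * d with hC
  have hC0 : 0 ≤ C := by positivity
  set m := η * Real.exp (-(K * B)) * (K * d) with hm
  have hm0 : 0 < m := by positivity
  refine ⟨min d (m / (C + 1)), lt_min hd (by positivity), fun l hl hgood h hh => ?_⟩
  have hhd : h ≤ d := hh.2.trans (min_le_left _ _)
  have hCh : C * h ≤ m := by
    have h1 : h * (C + 1) ≤ m := (le_div_iff₀ (by positivity)).1 (hh.2.trans (min_le_right _ _))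
    nlinarith [hh.1]
  have hl0 : 0 < l := by linarith [hl.1]
  have inner : ∀ x : Fin N → ℝ, x k ∈ Icc 0 (l - d) →
      0 ≤ u (Function.update x k (-1 * x k + 2 * (l + h))) - u x := by
    intro x hx
    have h1 := barrier_le_of_lap_le (k := k) (b := l) (K := K) (η := η)
      (w := fun x => u (Function.update x k (-1 * x k + 2 * l)) - u x) hK0 hη hl0
      (hu.reflect_continuousOn le_rfl le_rfl) hgood ?_ ?_ (x := x) ⟨hx.1, by linarith [hx.2]⟩
    · have h2 : m ≤ η * Real.exp (-(K * l)) * (Real.exp (K * (l - x k)) - 1) := by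
        have e1 : Real.exp (-(K * B)) ≤ Real.exp (-(K * l)) := by
          apply Real.exp_le_exp.2; nlinarith [hl.2]
        have e2 := Real.add_one_le_exp (K * (l - x k))
        have e3 : K * d ≤ K * (l - x k) := by gcongr; linarith [hx.2]
        rw [hm]
        gcongr
        linarith
      set y := Function.update x k h with hy
      have hyk : y k = h := by simp [hy]
      have h3 := hu.sub_le_of_reflect hf hfF hd (c := 2 * l + h - x k)
        (by linarith [hx.2, hh.1, hl.1]) (x := y) (by rw [hyk]; exact ⟨hh.1, hhd⟩)
      have e4 : Function.update y k (-1 * y k + (2 * l + h - x k)) =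
          Function.update x k (-1 * x k + 2 * l) := by
        rw [hyk, hy, Function.update_idem]; congr 1; ring
      have e5 : Function.update y k (1 * y k + (2 * l + h - x k)) =
          Function.update x k (-1 * x k + 2 * (l + h)) := by
        rw [hyk, hy, Function.update_idem]; congr 1; ring
      rw [e4, e5, hyk, ← hC] at h3
      linarith
    · intro y hy
      have h1 := hlow (Function.update y k (-1 * y k + 2 * l)) (by simp; linarith [hl.1])
      have h2 := hu.dir y hy
      linarith
    · intro y hy
      have c1 : 0 ≤ Function.update y k (-1 * y k + 2 * l) k := by simp; linarith [hy.2, hy.1]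
      obtain ⟨p, q, hpq, hq⟩ := hu.reflect_pde hy
      refine ⟨p, q, hpq, ?_⟩
      have h3 := hL _ ⟨hu.nonneg _ hy.1.le, hu.le _ hy.1.le⟩ _ ⟨hu.nonneg _ c1, hu.le _ c1⟩
      have h4 := hgood y ⟨hy.1.le, hy.2.le⟩
      rw [abs_sub_comm (u y), abs_of_nonneg (a := _ - u y) h4] at h3
      have := le_abs_self (f (u y) - f (u (Function.update y k (-1 * y k + 2 * l))))
      rw [hq]
      nlinarith
  intro x hx
  by_cases hxd : x k ≤ l - d
  · exact inner x ⟨hx.1, hxd⟩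
  · push Not at hxd
    have hld : 0 ≤ l - d := by linarith [hl.1]
    refine hu.reflect_nonneg_of_narrow hL0 hL hld (by linarith [hh.1]) ?_ ?_ ⟨hxd.le, hx.2⟩
    · refine le_trans ?_ hLd
      have : 0 ≤ l + h - (l - d) := by linarith [hh.1]
      gcongr
      linarith
    · intro y hy
      exact inner y ⟨by rw [hy]; exact hld, hy.le⟩

lemma reflectLE (hu : IsHalfSpaceSol k f M u) (hf : ∀ s, 0 ≤ s → 0 ≤ f s) (hL0 : 0 ≤ L)
    (hL : ∀ s ∈ Icc 0 M, ∀ t ∈ Icc 0 M, |f s - f t| ≤ L * |s - t|)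
    (hz : 0 < farInf k u) {l : ℝ} (hl : 0 < l) : ReflectLE k u l := by
  obtain ⟨d, hd, hLd⟩ : ∃ d > 0, L * (2 * d) ^ 2 ≤ 2 := by
    refine ⟨1 / (2 * (L + 1)), by positivity, ?_⟩
    have : 2 * (1 / (2 * (L + 1))) = 1 / (L + 1) := by field_simp
    rw [this, div_pow, one_pow, mul_one_div, div_le_iff₀ (by positivity)]
    nlinarith
  obtain ⟨τ, hτ, hstep⟩ := hu.reflectLE_step hf hL0 hL hz hd hLd l
  have key : ∀ n : ℕ, ∀ l' > 0, l' ≤ l → l' ≤ 2 * d + n * τ → ReflectLE k u l' := by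
    intro n
    induction n with
    | zero =>
      intro l' h0 _ h2 x hx
      refine hu.reflect_nonneg_of_narrow hL0 hL le_rfl h0 ?_ ?_ hx
      · refine le_trans ?_ hLd
        simp only [Nat.cast_zero, zero_mul, add_zero] at h2
        rw [sub_zero]
        gcongr
      · intro y hy
        have := hu.dir y hy
        have := hu.nonneg (Function.update y k (-1 * y k + 2 * l')) (by simp; linarith)
        linarith
    | succ n ih =>
      intro l' h0 h1 h2
      push_cast at h2
      by_cases h3 : l' ≤ 2 * d + n * τ
      · exact ih l' h0 h1 h3
      · push Not at h3
        have hn : 0 ≤ (n : ℝ) * τ := by positivity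
        have h4 := hstep (2 * d + n * τ) ⟨by linarith, by linarith⟩
          (ih _ (by positivity) (by linarith) le_rfl) (l' - (2 * d + n * τ))
          ⟨by linarith, by linarith⟩
        rwa [add_sub_cancel] at h4
  obtain ⟨n, hn⟩ := exists_nat_ge (l / τ)
  have hn' : l ≤ n * τ := (div_le_iff₀ hτ).1 hn
  exact key n l hl le_rfl (by linarith)

/-- If its lower limit far from the boundary is positive, `u` is nondecreasing in the direction
orthogonal to the boundary. -/
lemma le_update (hu : IsHalfSpaceSol k f M u) (hf : ∀ s, 0 ≤ s → 0 ≤ f s) (hL0 : 0 ≤ L)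
    (hL : ∀ s ∈ Icc 0 M, ∀ t ∈ Icc 0 M, |f s - f t| ≤ L * |s - t|)
    (hz : 0 < farInf k u) {x : Fin N → ℝ} (hx : 0 ≤ x k) {t : ℝ} (ht : x k ≤ t) :
    u x ≤ u (Function.update x k t) := by
  rcases eq_or_lt_of_le ht with rfl | hlt
  · rw [Function.update_eq_self]
  · have := hu.reflectLE hf hL0 hL hz (l := (x k + t) / 2) (by linarith) x
      ⟨hx, by linarith⟩
    have e : -1 * x k + 2 * ((x k + t) / 2) = t := by ring
    rw [e] at this
    linarith

end IsHalfSpaceSol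

/-! ### The upper bound by the lower limit -/

lemma sqDist_add {N : ℕ} (y v : Fin N → ℝ) : sqDist y (y + v) = sqDist 0 v := by
  simp [sqDist]

lemma sqDist_update {N : ℕ} (y : Fin N → ℝ) (k : Fin N) (t : ℝ) :
    sqDist y (Function.update y k t) = (t - y k) ^ 2 := by
  unfold sqDist
  rw [Finset.sum_eq_single k]
  · simp
  · intro i _ hi; simp [Function.update_of_ne hi]
  · simp

lemma abs_sub_coord_le {N : ℕ} {x y : Fin N → ℝ} {r : ℝ} (hr : 0 ≤ r) (h : sqDist y x ≤ r ^ 2)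
    (k : Fin N) : |x k - y k| ≤ r :=
  abs_le_of_sq_le_sq ((sq_coord_le_sqDist y x k).trans h) hr

/-- A neighbourhood in the form of a Euclidean ball. -/
lemma exists_sqDist_ball {N : ℕ} {y : Fin N → ℝ} {P : (Fin N → ℝ) → Prop}
    (h : ∀ᶠ x in nhds y, P x) : ∃ r > 0, ∀ x, sqDist y x ≤ r ^ 2 → P x := by
  obtain ⟨r, hr, hP⟩ := Metric.eventually_nhds_iff.1 h
  refine ⟨r / 2, by positivity, fun x hx => hP ?_⟩
  refine (dist_pi_lt_iff hr).2 fun i => ?_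
  rw [Real.dist_eq]
  have := abs_sub_coord_le (by positivity) hx i
  linarith

namespace IsHalfSpaceSol

variable {N : ℕ} {k : Fin N} {f : ℝ → ℝ} {M L : ℝ} {u : (Fin N → ℝ) → ℝ}

/-- Propagation of a strict lower bound from a small ball to a larger one. -/
lemma add_exp_le_of_ball (hu : IsHalfSpaceSol k f M u) (hf : ∀ s, 0 ≤ s → 0 ≤ f s)
    {r ρ δ β κ : ℝ} (hr : 0 < r) (hδ : 0 < δ) (hκ : κ = (N + 1) / (2 * r ^ 2))
    {y : Fin N → ℝ} (hy : ρ ≤ y k) (hρ : 0 < ρ)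
    (hβ : ∀ x, sqDist y x ≤ ρ ^ 2 → β ≤ u x) (hβδ : ∀ x, sqDist y x ≤ r ^ 2 → β + δ ≤ u x)
    {x : Fin N → ℝ} (hx : sqDist y x ≤ ρ ^ 2) :
    β + δ * (Real.exp (-κ * sqDist y x + 0) - Real.exp (-κ * ρ ^ 2 + 0)) ≤ u x := by
  have hκ0 : 0 < κ := by rw [hκ]; positivity
  have hκr : 2 * κ * r ^ 2 = N + 1 := by rw [hκ]; field_simp
  have hin : ∀ x, sqDist y x ≤ r ^ 2 →
      β + δ * (Real.exp (-κ * sqDist y x + 0) - Real.exp (-κ * ρ ^ 2 + 0)) ≤ u x := by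
    intro x hx
    have h1 := hβδ x hx
    have h2 : Real.exp (-κ * sqDist y x + 0) ≤ 1 := by
      rw [Real.exp_le_one_iff]; nlinarith [sqDist_nonneg y x]
    have h3 := Real.exp_pos (-κ * ρ ^ 2 + 0)
    nlinarith
  set S := {x : Fin N → ℝ | sqDist y x ≤ ρ ^ 2} ∩ {x | r ^ 2 ≤ sqDist y x} with hS
  have hScomp : IsCompact S := (isCompact_sqDist_le y _).inter_right
    (isClosed_le continuous_const (continuous_sqDist y))
  have hpos : ∀ x : Fin N → ℝ, sqDist y x ≤ ρ ^ 2 → 0 ≤ x k := by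
    intro x hx
    have := abs_le.1 (abs_sub_coord_le hρ.le hx k)
    linarith [this.1]
  set g : (Fin N → ℝ) → ℝ := fun x =>
    (β - δ * Real.exp (-κ * ρ ^ 2 + 0) + δ * Real.exp (-κ * sqDist y x + 0)) - u x with hg
  have hgc : ContinuousOn g S := by
    refine ContinuousOn.sub (Continuous.continuousOn ?_) (hu.cont.mono fun x hx => hpos x hx.1)
    have := continuous_sqDist y
    fun_prop
  by_cases hxr : sqDist y x ≤ r ^ 2
  · exact hin x hxr
  push Not at hxr
  obtain ⟨x₁, hx₁, hmax⟩ := hScomp.exists_isMaxOn ⟨x, hx, hxr.le⟩ hgc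
  have hle : g x ≤ g x₁ := hmax ⟨hx, hxr.le⟩
  suffices hsuff : g x₁ ≤ 0 by
    have := hle.trans hsuff
    simp only [hg] at this
    linarith
  by_contra! hgpos
  have h1 : r ^ 2 < sqDist y x₁ := by
    by_contra! hcon
    have := hin x₁ hcon
    simp only [hg] at hgpos
    linarith
  have h2 : sqDist y x₁ < ρ ^ 2 := by
    by_contra! hcon
    have e : sqDist y x₁ = ρ ^ 2 := le_antisymm hx₁.1 hcon
    have := hβ x₁ hx₁.1
    simp only [hg, e] at hgpos
    linarith
  have hlm : IsLocalMax g x₁ := by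
    have hc := (continuous_sqDist y).continuousAt (x := x₁)
    filter_upwards [hc.eventually (lt_mem_nhds h1), hc.eventually (gt_mem_nhds h2)] with x a b
    exact hmax ⟨b.le, a.le⟩
  have hx₁k : 0 < x₁ k := by
    have := (abs_lt_of_sq_lt_sq ((sq_coord_le_sqDist y x₁ k).trans_lt h2) hρ.le)
    have := (abs_lt.1 this).1
    linarith
  obtain ⟨p, q, hpq, hq⟩ := hu.pde x₁ hx₁k
  have h9 := HasPureDerivs.comp (T := fun s => β - δ * Real.exp (-κ * ρ ^ 2 + 0) +
    δ * Real.exp (-κ * s + 0)) ((HasSecondDeriv.const _ _).add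
    ((HasSecondDeriv.exp_affine (-κ) 0 (sqDist y x₁)).const_mul δ)) (hasPureDerivs_sqDist y x₁)
  have h10 := ((h9.sub hpq).of_isLocalMax hlm).2
  have h11 := Finset.sum_nonpos fun i (_ : i ∈ Finset.univ) => h10 i
  simp only [Pi.sub_apply, Finset.sum_sub_distrib, Finset.sum_add_distrib, zero_add, mul_pow,
    ← Finset.mul_sum, hq, Finset.sum_const, Finset.card_univ, Fintype.card_fin, nsmul_eq_mul]
    at h11
  have h12 : ∑ i, (x₁ i - y i) ^ 2 = sqDist y x₁ := rfl
  rw [h12] at h11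
  have h13 := hf _ (hu.nonneg x₁ hx₁k.le)
  have h14 : 0 < δ * Real.exp (-κ * sqDist y x₁ + 0) := by positivity
  set E := Real.exp (-κ * sqDist y x₁ + 0)
  have h15 : (N : ℝ) + 1 ≤ 2 * κ * sqDist y x₁ := by
    rw [← hκr]; gcongr
  have h16 : 0 < (δ * E) * (2 * κ * (2 * κ * sqDist y x₁ - N)) :=
    mul_pos h14 (mul_pos (by positivity) (by linarith))
  nlinarith

/-- Uniform version of `add_exp_le_of_ball`. -/
lemma exists_add_le_of_ball (hu : IsHalfSpaceSol k f M u) (hf : ∀ s, 0 ≤ s → 0 ≤ f s)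
    {r R ρ δ : ℝ} (hr : 0 < r) (hδ : 0 < δ) (hR : 0 < R) (hRρ : R < ρ) :
    ∃ γ > 0, ∀ β, ∀ y : Fin N → ℝ, ρ ≤ y k → (∀ x, sqDist y x ≤ ρ ^ 2 → β ≤ u x) →
      (∀ x, sqDist y x ≤ r ^ 2 → β + δ ≤ u x) → ∀ x, sqDist y x ≤ R ^ 2 → β + γ ≤ u x := by
  set κ : ℝ := (N + 1) / (2 * r ^ 2) with hκ
  have hκ0 : 0 < κ := by positivity
  have hR2 : R ^ 2 < ρ ^ 2 := by gcongr
  refine ⟨δ * (Real.exp (-κ * R ^ 2 + 0) - Real.exp (-κ * ρ ^ 2 + 0)),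
    mul_pos hδ (sub_pos.2 (Real.exp_lt_exp.2 (by nlinarith))), fun β y hy h1 h2 x hx => ?_⟩
  refine le_trans ?_ (hu.add_exp_le_of_ball hf hr hδ hκ hy (hR.trans hRρ) h1 h2 (hx.trans hR2.le))
  gcongr β + δ * (?_ - _)
  apply Real.exp_le_exp.2
  nlinarith

/-- Sliding a compactly supported bump parallel to the boundary. -/
lemma bump_le_of_start (hu : IsHalfSpaceSol k f M u) {R c b η δ z : ℝ} (hR : 0 < R)
    (hc : 0 < c) (hδ : 0 < δ) (hfc : ∀ v, 0 ≤ v → v ≤ z + η → c * (v - z) ≤ f v)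
    (hRc : (8 + 4 * (N:ℝ)) ^ 2 / (4 * c) + 1 ≤ 8 * R ^ 2) (hbδ : c * (z - b) < δ)
    (hbη : b + δ * (R ^ 2) ^ 2 ≤ z + η) {y₀ y₁ : Fin N → ℝ} (hk : y₁ k = y₀ k) (hRy : R < y₀ k)
    (hb : ∀ x : Fin N → ℝ, y₀ k - R ≤ x k → b < u x)
    (hstart : ∀ x, sqDist y₀ x ≤ R ^ 2 → b + δ * (R ^ 2) ^ 2 < u x) :
    b + δ * (R ^ 2) ^ 2 < u y₁ := by
  set y : ℝ → Fin N → ℝ := fun s => y₀ + s • (y₁ - y₀) with hy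
  have hyk : ∀ s, y s k = y₀ k := by intro s; simp [hy, hk]
  set φ : (Fin N → ℝ) → ℝ := fun v => b + δ * (R ^ 2 - sqDist 0 v) ^ 2 with hφ
  have hQ := continuous_sqDist (0 : Fin N → ℝ)
  have hφle : ∀ v, sqDist 0 v ≤ R ^ 2 → φ v ≤ b + δ * (R ^ 2) ^ 2 := by
    intro v hv
    have := sqDist_nonneg 0 v
    simp only [hφ]
    gcongr
    linarith
  set K : Set (ℝ × (Fin N → ℝ)) := Icc 0 1 ×ˢ {v | sqDist 0 v ≤ R ^ 2} with hK
  have hKc : IsCompact K := isCompact_Icc.prod (isCompact_sqDist_le 0 _)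
  have hvk : ∀ (s : ℝ) (v : Fin N → ℝ), sqDist 0 v ≤ R ^ 2 → y₀ k - R ≤ (y s + v) k := by
    intro s v hv
    have := (abs_le.1 (abs_sub_coord_le hR.le hv k)).1
    simp only [Pi.zero_apply, sub_zero] at this
    simp only [Pi.add_apply, hyk]
    linarith
  have hucont : ContinuousOn (fun w : ℝ × (Fin N → ℝ) => u (y w.1 + w.2)) K := by
    refine hu.cont.comp (Continuous.continuousOn (by simp only [hy]; fun_prop)) fun w hw => ?_
    have := hvk w.1 w.2 hw.2
    simp only [mem_ofPred_eq]
    linarith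
  have hgc : ContinuousOn (fun w : ℝ × (Fin N → ℝ) => u (y w.1 + w.2) - φ w.2) K :=
    hucont.sub (Continuous.continuousOn (by simp only [hφ]; fun_prop))
  set A := K ∩ (fun w : ℝ × (Fin N → ℝ) => u (y w.1 + w.2) - φ w.2) ⁻¹' Iic 0 with hA
  have hAc : IsCompact A :=
    hKc.of_isClosed_subset (hgc.preimage_isClosed_of_isClosed hKc.isClosed isClosed_Iic)
      inter_subset_left
  rcases A.eq_empty_or_nonempty with hAe | hAne
  · by_contra! hcon
    have h1 : ((1:ℝ), (0 : Fin N → ℝ)) ∈ A := by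
      refine ⟨⟨by simp, by simp [sq_nonneg]⟩, ?_⟩
      simpa [hy, hφ] using hcon
    rw [hAe] at h1
    exact h1
  exfalso
  obtain ⟨⟨s, v⟩, hsv, hmin⟩ := hAc.exists_isMinOn hAne continuous_fst.continuousOn
  have hv : sqDist 0 v ≤ R ^ 2 := hsv.1.2
  have hs01 : s ∈ Icc (0:ℝ) 1 := hsv.1.1
  have hle : u (y s + v) ≤ φ v := by
    have := hsv.2
    simpa using this
  have hs0 : 0 < s := by
    rcases eq_or_lt_of_le hs01.1 with h | h
    · exfalso
      have h1 := hstart (y s + v) (by rw [← h]; simpa [hy, sqDist_add] using hv)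
      have h2 := hφle v hv
      linarith
    · exact h
  have hge : ∀ w, sqDist 0 w ≤ R ^ 2 → φ w ≤ u (y s + w) := by
    intro w hw
    have h1 : ∀ s' ∈ Ico 0 s, φ w ≤ u (y s' + w) := by
      intro s' hs'
      by_contra! hcon
      have : (s', w) ∈ A := ⟨⟨⟨hs'.1, hs'.2.le.trans hs01.2⟩, hw⟩, by
        simp only [mem_preimage, mem_Iic]; linarith⟩
      have := hmin this
      simp only [mem_ofPred_eq] at this
      linarith [hs'.2]
    have h2 : ContinuousOn (fun s' => u (y s' + w)) (Icc 0 1) :=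
      hucont.comp (f := fun s' : ℝ => (s', w)) (by fun_prop) fun s' hs' => ⟨hs', hw⟩
    have h3 : Tendsto (fun s' => u (y s' + w)) (nhdsWithin s (Ico 0 s)) (nhds (u (y s + w))) :=
      (h2 s hs01).mono_left (nhdsWithin_mono _ fun a ha => ⟨ha.1, ha.2.le.trans hs01.2⟩)
    have h4 : (nhdsWithin s (Ico 0 s)).NeBot := by
      rw [← mem_closure_iff_nhdsWithin_neBot, closure_Ico hs0.ne]
      exact ⟨hs0.le, le_rfl⟩
    exact ge_of_tendsto h3 (eventually_mem_nhdsWithin.mono h1)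
  have heq : u (y s + v) = φ v := le_antisymm hle (hge v hv)
  have hvlt : sqDist 0 v < R ^ 2 := by
    by_contra! hcon
    have e : sqDist 0 v = R ^ 2 := le_antisymm hv hcon
    have := hb (y s + v) (hvk s v hv)
    rw [heq] at this
    simp [hφ, e] at this
  set x := y s + v with hx
  have hxQ : sqDist (y s) x = sqDist 0 v := sqDist_add _ _
  have hxk : 0 < x k := by have := hvk s v hv; linarith
  have hlm : IsLocalMax (fun x => (b + δ * (R ^ 2) ^ 2 + (-2 * δ * R ^ 2) * sqDist (y s) x +
      δ * sqDist (y s) x ^ 2) - u x) x := by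
    have hcx := (continuous_sqDist (y s)).continuousAt (x := x)
    filter_upwards [hcx.eventually (gt_mem_nhds (hxQ ▸ hvlt))] with x' hx'
    have h1 : sqDist (y s) x' = sqDist 0 (x' - y s) := by simp [sqDist]
    have h2 := hge (x' - y s) (h1 ▸ hx'.le)
    rw [add_sub_cancel] at h2
    simp only [hφ, ← h1] at h2
    simp only [hφ, ← hxQ] at heq
    linarith
  obtain ⟨p, q, hpq, hq⟩ := hu.pde x hxk
  have h9 := HasPureDerivs.comp (T := fun s => b + δ * (R ^ 2) ^ 2 + (-2 * δ * R ^ 2) * s +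
      δ * s ^ 2) (HasSecondDeriv.quadratic _ _ _ (sqDist (y s) x))
    (hasPureDerivs_sqDist (y s) x)
  have h10 := ((h9.sub hpq).of_isLocalMax hlm).2
  have h11 := Finset.sum_nonpos fun i (_ : i ∈ Finset.univ) => h10 i
  simp only [Pi.sub_apply, Finset.sum_sub_distrib, Finset.sum_add_distrib, mul_pow,
    ← Finset.mul_sum, hq, Finset.sum_const, Finset.card_univ, Fintype.card_fin, nsmul_eq_mul]
    at h11
  have h12 : ∑ i, (x i - y s i) ^ 2 = sqDist 0 v := hxQ
  rw [h12, hxQ] at h11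
  have h13 := hfc (u x) (hu.nonneg x hxk.le) (by rw [heq]; exact (hφle v hv).trans hbη)
  rw [heq] at h11 h13
  set r := R ^ 2 - sqDist 0 v with hr
  have hQr : sqDist 0 v = R ^ 2 - r := by rw [hr]; ring
  have h14 : 1 ≤ 8 * R ^ 2 - (8 + 4 * (N:ℝ)) * r + c * r ^ 2 := by
    have e : 8 * R ^ 2 - (8 + 4 * (N:ℝ)) * r + c * r ^ 2 =
        8 * R ^ 2 - (8 + 4 * (N:ℝ)) ^ 2 / (4 * c) +
          c * (r - (8 + 4 * (N:ℝ)) / (2 * c)) ^ 2 := by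
      field_simp; ring
    rw [e]
    have : 0 ≤ c * (r - (8 + 4 * (N:ℝ)) / (2 * c)) ^ 2 := by positivity
    linarith
  have h15 : φ v = b + δ * r ^ 2 := rfl
  rw [hQr] at h11
  rw [h15] at h11 h13
  have h16 := mul_le_mul_of_nonneg_left h14 hδ.le
  nlinarith

lemma exists_pos_of_pos (hu : IsHalfSpaceSol k f M u) (hf : ∀ s, 0 ≤ s → 0 ≤ f s)
    {x₀ : Fin N → ℝ} (hx₀ : 0 < x₀ k) (h0 : 0 < u x₀) (T : ℝ) :
    ∃ x : Fin N → ℝ, T ≤ x k ∧ 0 < x k ∧ 0 < u x := by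
  have step : ∀ x : Fin N → ℝ, 0 < x k → 0 < u x →
      0 < u (Function.update x k (3 / 2 * x k)) := by
    intro x hx hux
    have hc : ContinuousAt u x := hu.cont.continuousAt
      (mem_of_superset ((isOpen_lt continuous_const (continuous_apply k)).mem_nhds hx)
        fun y (hy : 0 < y k) => hy.le)
    obtain ⟨r, hr, hball⟩ := exists_sqDist_ball (hc.eventually (lt_mem_nhds (half_lt_self hux)))
    obtain ⟨γ, hγ, h⟩ := hu.exists_add_le_of_ball hf hr (half_pos hux)
      (R := x k / 2) (ρ := x k) (by positivity) (by linarith)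
    have := h 0 x le_rfl (fun y hy => hu.nonneg y ?_) (fun y hy => ?_)
      (Function.update x k (3 / 2 * x k)) ?_
    · linarith
    · have := (abs_le.1 (abs_sub_coord_le hx.le hy k)).1
      linarith
    · rw [zero_add]; exact (hball y hy).le
    · rw [sqDist_update]; apply le_of_eq; ring
  have chain : ∀ n : ℕ, ∃ x : Fin N → ℝ, (3 / 2 : ℝ) ^ n * x₀ k ≤ x k ∧ 0 < x k ∧ 0 < u x := by
    intro n
    induction n with
    | zero => exact ⟨x₀, by simp, hx₀, h0⟩
    | succ n ih =>
      obtain ⟨x, h1, h2, h3⟩ := ih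
      refine ⟨_, ?_, ?_, step x h2 h3⟩
      · rw [Function.update_self, pow_succ]; linarith
      · rw [Function.update_self]; positivity
  obtain ⟨n, hn⟩ := pow_unbounded_of_one_lt (T / x₀ k) (by norm_num : (1:ℝ) < 3 / 2)
  obtain ⟨x, h1, h2⟩ := chain n
  exact ⟨x, ((div_lt_iff₀ hx₀).1 hn).le.trans h1, h2⟩

/-- If `u` exceeds its lower limit on balls of fixed size far from the boundary, then a
contradiction arises from sliding a bump. -/
lemma false_of_large_balls (hu : IsHalfSpaceSol k f M u) (hf : ∀ s, 0 ≤ s → 0 ≤ f s)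
    {R c η : ℝ} (hR : 0 < R) (hc : 0 < c) (hη : 0 < η)
    (hfc : ∀ v, 0 ≤ v → v ≤ farInf k u + η → c * (v - farInf k u) ≤ f v)
    (hRc : (8 + 4 * (N:ℝ)) ^ 2 / (4 * c) + 1 ≤ 8 * R ^ 2)
    (hballs : ∃ r > 0, ∃ δ > 0, ∀ e > 0, ∃ y : Fin N → ℝ, 2 * R ≤ y k ∧
      (∀ x : Fin N → ℝ, y k - 2 * R ≤ x k → farInf k u - e < u x) ∧
      ∀ x, sqDist y x ≤ r ^ 2 → farInf k u + δ ≤ u x) : False := by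
  obtain ⟨r, hr, δ₀, hδ₀, hy⟩ := hballs
  set z := farInf k u with hz
  have hz0 : 0 ≤ z := hu.farInf_nonneg
  obtain ⟨γ, hγ, hann⟩ := hu.exists_add_le_of_ball hf hr hδ₀ hR (by linarith : R < 2 * R)
  set δ := min η γ / 2 / (R ^ 2) ^ 2 with hδ
  have hmin : 0 < min η γ := lt_min hη hγ
  have hδ0 : 0 < δ := by positivity
  have hδR : δ * (R ^ 2) ^ 2 = min η γ / 2 := by rw [hδ]; field_simp
  set e := min (δ / (2 * c)) (δ * (R ^ 2) ^ 2 / 2) with he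
  have he0 : 0 < e := by positivity
  have he1 : c * e ≤ δ / 2 := by
    calc c * e ≤ c * (δ / (2 * c)) := by gcongr; exact min_le_left _ _
      _ = δ / 2 := by field_simp
  have he2 : e ≤ δ * (R ^ 2) ^ 2 / 2 := min_le_right _ _
  obtain ⟨y₀, hy1, hy2, hy3⟩ := hy e he0
  have hγ' := min_le_right η γ
  have hη' := min_le_left η γ
  have hbnd : ∀ x, sqDist y₀ x ≤ R ^ 2 → z - e + γ ≤ u x :=
    hann (z - e) y₀ hy1 (fun x hx => (hy2 x (by
      have := (abs_le.1 (abs_sub_coord_le (by positivity) hx k)).1; linarith)).le)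
      fun x hx => by linarith [hy3 x hx]
  have hconc : ∀ y₁ : Fin N → ℝ, y₁ k = y₀ k → z - e + δ * (R ^ 2) ^ 2 ≤ u y₁ := by
    intro y₁ hk
    refine (hu.bump_le_of_start hR hc hδ0 hfc hRc (by linarith) (by linarith) hk (by linarith)
      (fun x hx => hy2 x (by linarith)) fun x hx => ?_).le
    have := hbnd x hx
    linarith
  have hmem : z - e + δ * (R ^ 2) ^ 2 ∈ farLowerBounds k u :=
    ⟨y₀ k, by linarith, fun x hx => hu.le_of_le_at_height hf (by linarith) (by linarith) hconc hx⟩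
  have := hu.le_farInf hmem
  linarith

lemma le_farInf_of_H2 (hu : IsHalfSpaceSol k f M u) (hH2 : H2 f) (hL0 : 0 ≤ L)
    (hL : ∀ s ∈ Icc 0 M, ∀ t ∈ Icc 0 M, |f s - f t| ≤ L * |s - t|)
    (hfz : f (farInf k u) = 0) {x : Fin N → ℝ} (hx : 0 ≤ x k) : u x ≤ farInf k u := by
  obtain ⟨-, hf, hlim⟩ := hH2
  have hz0 : 0 ≤ farInf k u := hu.farInf_nonneg
  by_contra! hlt
  have hx0 : 0 < x k := by
    rcases eq_or_lt_of_le hx with h | h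
    · have := hu.dir x h.symm; linarith
    · exact h
  obtain ⟨c, hc, hev⟩ := hlim _ hz0 hfz
  obtain ⟨η, hη, hfc⟩ : ∃ η > 0, ∀ v, 0 ≤ v → v ≤ farInf k u + η →
      c * (v - farInf k u) ≤ f v := by
    rw [eventually_nhdsWithin_iff, Metric.eventually_nhds_iff] at hev
    obtain ⟨r, hr, h⟩ := hev
    refine ⟨r / 2, by positivity, fun v hv0 hv => ?_⟩
    by_cases hvz : v ≤ farInf k u
    · have := hf v hv0
      nlinarith
    · push Not at hvz
      have := h (y := v) (by rw [Real.dist_eq, abs_of_pos (by linarith)]; linarith) hvz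
      exact (le_div_iff₀ (by linarith)).1 this
  obtain ⟨R, hR, hRc⟩ : ∃ R > 0, (8 + 4 * (N:ℝ)) ^ 2 / (4 * c) + 1 ≤ 8 * R ^ 2 := by
    have h0 : 0 ≤ (8 + 4 * (N:ℝ)) ^ 2 / (4 * c) := by positivity
    exact ⟨(8 + 4 * (N:ℝ)) ^ 2 / (4 * c) + 1, by positivity, by nlinarith⟩
  have hcont : ∀ y : Fin N → ℝ, 0 < y k → ContinuousAt u y := fun y hy =>
    hu.cont.continuousAt (mem_of_superset
      ((isOpen_lt continuous_const (continuous_apply k)).mem_nhds hy)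
        fun y (hy : 0 < y k) => hy.le)
  refine hu.false_of_large_balls hf hR hc hη hfc hRc ?_
  rcases eq_or_lt_of_le hz0 with hz | hz
  · rw [← hz] at hlt ⊢
    obtain ⟨y, hy1, hy2, hy3⟩ := hu.exists_pos_of_pos hf hx0 hlt (2 * R)
    obtain ⟨r, hr, hball⟩ := exists_sqDist_ball
      ((hcont y hy2).eventually (lt_mem_nhds (half_lt_self hy3)))
    refine ⟨r, hr, u y / 2, by positivity, fun e he => ⟨y, hy1, fun x' hx' => ?_, fun x' hx' => ?_⟩⟩
    · have := hu.nonneg x' (by linarith)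
      linarith
    · rw [zero_add]; exact (hball x' hx').le
  · set δ := (u x - farInf k u) / 2 with hδ
    have hδ0 : 0 < δ := by rw [hδ]; linarith
    obtain ⟨r, hr, hball⟩ := exists_sqDist_ball
      (((hcont x hx0).eventually (lt_mem_nhds (show farInf k u + δ < u x by linarith))).and
        ((isOpen_lt continuous_const (continuous_apply k)).mem_nhds hx0))
    refine ⟨r, hr, δ, hδ0, fun e he => ?_⟩
    obtain ⟨T, hT0, hT⟩ := hu.exists_height (c := farInf k u - e / 2) (by linarith)
    refine ⟨Function.update x k (x k + (T + 2 * R)), by simp; linarith, fun x' hx' => ?_,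
      fun x' hx' => ?_⟩
    · have := hT x' (by simp at hx'; linarith)
      linarith
    · have h1 : sqDist x (Function.update x' k (x' k - (T + 2 * R))) =
          sqDist (Function.update x k (x k + (T + 2 * R))) x' := by
        unfold sqDist
        refine Finset.sum_congr rfl fun i _ => ?_
        by_cases hik : i = k
        · subst hik; simp; ring
        · simp [Function.update_of_ne hik]
      obtain ⟨h2, h3⟩ := hball _ (h1.trans_le hx')
      have h4 := hu.le_update hf hL0 hL hz (x := Function.update x' k (x' k - (T + 2 * R)))
        (le_of_lt h3) (t := x' k) (by simp; linarith)
      rw [Function.update_idem, Function.update_eq_self] at h4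
      linarith

end IsHalfSpaceSol

/-! ### Comparison with one-dimensional travel times -/

/-- The integral of `g` from `s` to `b`, as a function of `s`. -/
def energyGap (g : ℝ → ℝ) (b s : ℝ) : ℝ := ∫ σ in s..b, g σ

section energyGap

variable {g : ℝ → ℝ} {a b s t z : ℝ}

lemma hasDerivAt_energyGap (hg : Continuous g) (b s : ℝ) :
    HasDerivAt (energyGap g b) (-g s) s :=
  intervalIntegral.integral_hasDerivAt_left (hg.intervalIntegrable _ _)
    (hg.stronglyMeasurableAtFilter _ _) hg.continuousAt

lemma continuous_energyGap (hg : Continuous g) (b : ℝ) : Continuous (energyGap g b) :=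
  continuous_iff_continuousAt.2 fun s => (hasDerivAt_energyGap hg b s).continuousAt

lemma energyGap_self : energyGap g b b = 0 := by simp [energyGap]

lemma energyGap_nonneg (hg0 : ∀ s, 0 ≤ g s) (h : s ≤ b) : 0 ≤ energyGap g b s :=
  intervalIntegral.integral_nonneg h fun _ _ => hg0 _

lemma energyGap_anti (hg : Continuous g) (hg0 : ∀ s, 0 ≤ g s) : Antitone (energyGap g b) :=
  antitone_of_deriv_nonpos (fun s => (hasDerivAt_energyGap hg b s).differentiableAt) fun s => by
    rw [(hasDerivAt_energyGap hg b s).deriv]; linarith [hg0 s]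

lemma energyGap_sub (hg : Continuous g) : energyGap g z s - energyGap g z b = energyGap g b s :=
  sub_eq_of_eq_add (intervalIntegral.integral_add_adjacent_intervals
    (hg.intervalIntegrable _ _) (hg.intervalIntegrable _ _)).symm

lemma energyGap_eq_zero (hgz : ∀ s, z ≤ s → g s = 0) (h : z ≤ s) : energyGap g z s = 0 := by
  unfold energyGap
  rw [intervalIntegral.integral_congr (g := fun _ => (0:ℝ))]
  · simp
  · intro σ hσ
    rw [uIcc_of_ge h] at hσ
    exact hgz σ hσ.1

lemma energyGap_le_mul (hg : Continuous g) {G : ℝ} (hG : ∀ s, g s ≤ G) (h : s ≤ b) :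
    energyGap g b s ≤ G * (b - s) := by
  have := intervalIntegral.integral_mono_on h (hg.intervalIntegrable (μ := MeasureTheory.volume) _ _)
    ((continuous_const (y := G)).intervalIntegrable _ _) fun x _ => hG x
  rw [intervalIntegral.integral_const, smul_eq_mul] at this
  unfold energyGap
  linarith

end energyGap

/-- The time needed to travel from `0` to `w` with speed `√(2 P)`. -/
def travelTime (P : ℝ → ℝ) (w : ℝ) : ℝ := ∫ s in (0:ℝ)..w, 1 / Real.sqrt (2 * P s)

section travelTime

variable {P : ℝ → ℝ} {h t a b : ℝ}

lemma continuous_slowness (hP : Continuous P) (hP0 : ∀ s, 0 < P s) :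
    Continuous fun s => 1 / Real.sqrt (2 * P s) :=
  continuous_const.div (by fun_prop) fun s => (Real.sqrt_pos.2 (by linarith [hP0 s])).ne'

lemma hasSecondDeriv_travelTime (hP : Continuous P) (hP0 : ∀ s, 0 < P s)
    (hP' : HasDerivAt P (-h) t) :
    HasSecondDeriv (travelTime P) t (1 / Real.sqrt (2 * P t))
      (h / (2 * P t * Real.sqrt (2 * P t))) := by
  have hc := continuous_slowness hP hP0
  refine HasSecondDeriv.of_forall (φ' := fun s => 1 / Real.sqrt (2 * P s)) (fun s =>
    intervalIntegral.integral_hasDerivAt_right (hc.intervalIntegrable _ _)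
      (hc.stronglyMeasurableAtFilter _ _) hc.continuousAt) ?_
  have h0 : 0 < 2 * P t := by linarith [hP0 t]
  have h1 : 0 < Real.sqrt (2 * P t) := Real.sqrt_pos.2 h0
  have h2 := ((hP'.const_mul 2).sqrt h0.ne').inv h1.ne'
  simp only [one_div]
  refine h2.congr_deriv ?_
  rw [Real.sq_sqrt h0.le]
  field_simp

lemma continuous_travelTime (hP : Continuous P) (hP0 : ∀ s, 0 < P s) :
    Continuous (travelTime P) :=
  continuous_iff_continuousAt.2 fun _ => (intervalIntegral.integral_hasDerivAt_right
    ((continuous_slowness hP hP0).intervalIntegrable _ _)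
    ((continuous_slowness hP hP0).stronglyMeasurableAtFilter _ _)
    (continuous_slowness hP hP0).continuousAt).continuousAt

@[simp] lemma travelTime_zero : travelTime P 0 = 0 := by simp [travelTime]

lemma travelTime_sub (hP : Continuous P) (hP0 : ∀ s, 0 < P s) (a b : ℝ) :
    travelTime P b - travelTime P a = ∫ s in a..b, 1 / Real.sqrt (2 * P s) :=
  sub_eq_of_eq_add' (intervalIntegral.integral_add_adjacent_intervals
    ((continuous_slowness hP hP0).intervalIntegrable _ _)
    ((continuous_slowness hP hP0).intervalIntegrable _ _)).symm

lemma mul_le_travelTime_sub (hP : Continuous P) (hP0 : ∀ s, 0 < P s) {C : ℝ} (hab : a ≤ b)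
    (hC : ∀ s ∈ Icc a b, P s ≤ C) :
    (b - a) * (1 / Real.sqrt (2 * C)) ≤ travelTime P b - travelTime P a := by
  rw [travelTime_sub hP hP0]
  have := intervalIntegral.integral_mono_on hab
    ((continuous_const (y := 1 / Real.sqrt (2 * C))).intervalIntegrable _ _)
    ((continuous_slowness hP hP0).intervalIntegrable (μ := MeasureTheory.volume) a b)
    fun s hs => ?_
  · rwa [intervalIntegral.integral_const, smul_eq_mul] at this
  · have h1 : 0 < Real.sqrt (2 * P s) := Real.sqrt_pos.2 (by linarith [hP0 s])
    have := hC s hs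
    gcongr

lemma travelTime_mono (hP : Continuous P) (hP0 : ∀ s, 0 < P s) (hab : a ≤ b) :
    travelTime P a ≤ travelTime P b := by
  have := travelTime_sub hP hP0 a b
  have h2 : 0 ≤ ∫ s in a..b, 1 / Real.sqrt (2 * P s) :=
    intervalIntegral.integral_nonneg hab fun s _ => by positivity
  linarith

lemma one_div_sqrt_sub_le {m X Y : ℝ} (hm : 0 < m) (hX : m ≤ X) (hXY : X ≤ Y) :
    1 / Real.sqrt X - 1 / Real.sqrt Y ≤ (Y - X) / (m * Real.sqrt m) := by
  have hX0 : 0 < X := hm.trans_le hX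
  have hY0 : 0 < Y := hX0.trans_le hXY
  have hp := Real.sqrt_pos.2 hm
  have hq := Real.sqrt_le_sqrt hX
  have hr := Real.sqrt_le_sqrt hXY
  have e1 := Real.sq_sqrt hm.le
  have e2 := Real.sq_sqrt hX0.le
  have e3 := Real.sq_sqrt hY0.le
  set p := Real.sqrt m
  set q := Real.sqrt X
  set r := Real.sqrt Y
  have hq0 : 0 < q := hp.trans_le hq
  have hr0 : 0 < r := hq0.trans_le hr
  have h1 : 1 / q - 1 / r = (r - q) / (q * r) := by field_simp
  rw [h1, ← e1, ← e2, ← e3]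
  rw [div_le_div_iff₀ (by positivity) (by positivity)]
  have h2 : p ^ 2 * p ≤ (r + q) * (q * r) := by
    calc p ^ 2 * p ≤ (q * r) * (r + q) := by
          have : p ≤ r := hq.trans hr
          have h3 : p * p ≤ q * r := mul_le_mul hq this hp.le hq0.le
          rw [sq]
          exact mul_le_mul h3 (by linarith) hp.le (by positivity)
      _ = _ := by ring
  nlinarith [mul_le_mul_of_nonneg_left h2 (sub_nonneg.2 hr)]

end travelTime

namespace IsHalfSpaceSol

variable {N : ℕ} {k : Fin N} {f g : ℝ → ℝ} {M z : ℝ} {u : (Fin N → ℝ) → ℝ}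

/-- The solution does not grow faster than any one-dimensional supersolution. -/
lemma travelTime_le (hu : IsHalfSpaceSol k f z u) (hg : Continuous g) (hg0 : ∀ s, 0 ≤ g s)
    (hgf : ∀ s ∈ Icc 0 z, g s = f s) (hgz : ∀ s, z ≤ s → g s = 0) {ε : ℝ} (hε : 0 < ε)
    {x₀ : Fin N → ℝ} (hx₀ : 0 ≤ x₀ k) :
    travelTime (fun s => energyGap g z s + ε * Real.exp (-s)) (u x₀) ≤ x₀ k := by
  set P : ℝ → ℝ := fun s => energyGap g z s + ε * Real.exp (-s) with hPdef
  have hA0 : ∀ s, 0 ≤ energyGap g z s := by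
    intro s
    rcases le_total s z with h | h
    · exact energyGap_nonneg hg0 h
    · exact (energyGap_eq_zero hgz h).ge
  have hP : Continuous P := (continuous_energyGap hg z).add (by fun_prop)
  have hP0 : ∀ s, 0 < P s := fun s => add_pos_of_nonneg_of_pos (hA0 s) (by positivity)
  have hP' : ∀ s, HasDerivAt P (-(g s + ε * Real.exp (-s))) s := by
    intro s
    have h1 := (hasDerivAt_energyGap hg z s).add (((hasDerivAt_id s).neg.exp).const_mul ε)
    exact h1.congr_deriv (by simp; ring)
  have hPle : ∀ s, 0 ≤ s → P s ≤ P 0 := by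
    intro s hs
    have h1 := energyGap_anti hg hg0 (b := z) hs
    have h2 : Real.exp (-s) ≤ Real.exp (-0) := Real.exp_le_exp.2 (by linarith)
    simp only [hPdef]
    gcongr
  by_contra! hlt
  set W := Real.sqrt (2 * P 0) with hW
  have hW0 : 0 < W := Real.sqrt_pos.2 (by linarith [hP0 0])
  set D := travelTime P (u x₀) - x₀ k with hD
  have hD0 : 0 < D := by linarith
  obtain ⟨δ, hδ, hδ1, hδ2⟩ : ∃ δ > 0, δ * sqDist 0 x₀ < D ∧
      2 * N * δ < ε * Real.exp (-z) / W := by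
    have hq : 0 < ε * Real.exp (-z) / W := by positivity
    have h1 : Tendsto (fun δ : ℝ => δ * sqDist 0 x₀) (nhdsWithin 0 (Ioi 0)) (nhds 0) := by
      have : Continuous fun δ : ℝ => δ * sqDist 0 x₀ := by fun_prop
      simpa using (this.tendsto 0).mono_left nhdsWithin_le_nhds
    have h2 : Tendsto (fun δ : ℝ => 2 * N * δ) (nhdsWithin 0 (Ioi 0)) (nhds 0) := by
      have : Continuous fun δ : ℝ => 2 * N * δ := by fun_prop
      simpa using (this.tendsto 0).mono_left nhdsWithin_le_nhds
    obtain ⟨δ, ⟨a, b⟩, c⟩ := (((h1.eventually (gt_mem_nhds hD0)).and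
      (h2.eventually (gt_mem_nhds hq))).and self_mem_nhdsWithin).exists
    exact ⟨δ, c, a, b⟩
  have hTc := continuous_travelTime hP hP0
  have hclosed : IsClosed {x : Fin N → ℝ | 0 ≤ x k} :=
    isClosed_le continuous_const (continuous_apply k)
  obtain ⟨x, hx, hmax⟩ := exists_penalized_max hclosed
    (g := fun x => travelTime P (u x) - x k) (B := travelTime P z)
    ((hTc.comp_continuousOn hu.cont).sub (Continuous.continuousOn (by fun_prop)))
    (fun x hx => by
      have := travelTime_mono hP hP0 (hu.le x hx)
      have : 0 ≤ x k := hx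
      linarith) hx₀ hδ
  have hge := hmax x₀ hx₀
  have hsq := sqDist_nonneg 0 x
  have hxk : 0 < x k := by
    rcases eq_or_lt_of_le (show 0 ≤ x k from hx) with h | h
    · exfalso
      have := hu.dir x h.symm
      simp only [this, travelTime_zero, ← h] at hge
      nlinarith
    · exact h
  have hlm : IsLocalMax (fun y => (travelTime P (u y) - y k) - δ * sqDist 0 y) x := by
    filter_upwards [(isOpen_lt continuous_const (continuous_apply k)).mem_nhds hxk] with y hy
    exact hmax y (le_of_lt hy)
  obtain ⟨p, q, hpq, hq⟩ := hu.pde x hxk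
  have hux : u x ∈ Icc 0 z := ⟨hu.nonneg x hx, hu.le x hx⟩
  have hid : HasSecondDeriv (fun s : ℝ => s) (x k) 1 0 :=
    HasSecondDeriv.of_forall (φ' := fun _ => 1) (fun s => hasDerivAt_id s) (hasDerivAt_const _ _)
  have hpd := ((HasPureDerivs.comp (hasSecondDeriv_travelTime hP hP0 (hP' (u x))) hpq).sub
    (HasPureDerivs.coord (k := k) hid)).sub ((hasPureDerivs_sqDist 0 x).const_mul δ)
  obtain ⟨hp0, hq0⟩ := hpd.of_isLocalMax hlm
  have hsum := Finset.sum_nonpos fun i (_ : i ∈ Finset.univ) => hq0 i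
  set r := Real.sqrt (2 * P (u x)) with hr
  have hr0 : 0 < r := Real.sqrt_pos.2 (by linarith [hP0 (u x)])
  have hr2 : 2 * P (u x) = r ^ 2 := (Real.sq_sqrt (by linarith [hP0 (u x)])).symm
  have hrW : r ≤ W := Real.sqrt_le_sqrt (by linarith [hPle (u x) hux.1])
  simp only [Pi.sub_apply, Pi.smul_apply, smul_eq_mul, Finset.sum_sub_distrib,
    Finset.sum_add_distrib, ← Finset.mul_sum, hq, Finset.sum_const, Finset.card_univ,
    Fintype.card_fin, nsmul_eq_mul, Finset.sum_pi_single', Finset.mem_univ, if_true, hr2] at hsum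
  have hpk := hp0 k
  simp only [Pi.sub_apply, Pi.smul_apply, smul_eq_mul, Pi.single_eq_same, Pi.zero_apply,
    sub_zero] at hpk
  have hpk' : r ≤ p k := by
    have h1 : p k = r * (1 + δ * (2 * x k)) := by
      have : 1 / r * p k = 1 + δ * (2 * x k) := by linarith
      rw [← this]; field_simp
    rw [h1]
    have : 0 ≤ δ * (2 * x k) := by positivity
    nlinarith
  have hS : r ^ 2 ≤ ∑ i, p i ^ 2 := by
    refine le_trans ?_ (Finset.single_le_sum (f := fun i => p i ^ 2) (fun _ _ => sq_nonneg _)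
      (Finset.mem_univ k))
    gcongr
  rw [← hgf _ hux] at hsum
  set H := g (u x) + ε * Real.exp (-u x) with hH
  have hH0 : 0 ≤ H := add_nonneg (hg0 _) (by positivity)
  have h1 : H / r ≤ H / (r ^ 2 * r) * ∑ i, p i ^ 2 := by
    calc H / r = H / (r ^ 2 * r) * r ^ 2 := by field_simp
      _ ≤ _ := by gcongr
  have h2 : ε * Real.exp (-z) / W ≤ H / r - 1 / r * g (u x) := by
    have e : H / r - 1 / r * g (u x) = ε * Real.exp (-u x) / r := by
      rw [hH]; field_simp; ring
    rw [e]
    gcongr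
    exact hux.2
  linarith

/-- The solution grows at least as fast as any one-dimensional subsolution, as long as it stays
below a level `b` which is exceeded above the height `τ`. -/
lemma le_travelTime (hu : IsHalfSpaceSol k f z u) (hg : Continuous g) (hg0 : ∀ s, 0 ≤ g s)
    (hgf : ∀ s ∈ Icc 0 z, g s = f s) {G : ℝ} (hG : ∀ s, g s ≤ G) {b τ η κ : ℝ}
    (hη : 0 < η) (hκ : 0 < κ) (hτ : ∀ x : Fin N → ℝ, τ ≤ x k → b ≤ u x)
    (hT : τ ≤ travelTime (fun s => Real.sqrt (energyGap g b s ^ 2 + η ^ 2) - η + κ) b)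
    {x₀ : Fin N → ℝ} (hx₀ : 0 ≤ x₀ k) (hub : u x₀ < b) :
    x₀ k ≤ travelTime (fun s => Real.sqrt (energyGap g b s ^ 2 + η ^ 2) - η + κ) (u x₀) := by
  set P : ℝ → ℝ := fun s => Real.sqrt (energyGap g b s ^ 2 + η ^ 2) - η + κ with hPdef
  have hA := continuous_energyGap hg b
  have hP : Continuous P := by simp only [hPdef]; fun_prop
  have hη1 : ∀ s, η ≤ Real.sqrt (energyGap g b s ^ 2 + η ^ 2) := fun s =>
    Real.le_sqrt_of_sq_le (by nlinarith [sq_nonneg (energyGap g b s)])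
  have hPκ : ∀ s, κ ≤ P s := fun s => by have := hη1 s; simp only [hPdef]; linarith
  have hP0 : ∀ s, 0 < P s := fun s => hκ.trans_le (hPκ s)
  have hP' : ∀ s, HasDerivAt P
      (-(g s * (energyGap g b s / Real.sqrt (energyGap g b s ^ 2 + η ^ 2)))) s := by
    intro s
    have h0 : energyGap g b s ^ 2 + η ^ 2 ≠ 0 := by positivity
    have h1 := (((((hasDerivAt_energyGap hg b s).pow 2).add_const (η ^ 2)).sqrt h0).sub_const
      η).add_const κ
    refine h1.congr_deriv ?_
    have : Real.sqrt (energyGap g b s ^ 2 + η ^ 2) ≠ 0 := (hη.trans_le (hη1 s)).ne'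
    simp
    field_simp
  have hG0 : 0 ≤ G := (hg0 0).trans (hG 0)
  have hx₀τ : x₀ k < τ := by
    by_contra! hcon
    linarith [hτ x₀ hcon]
  have hτ0 : 0 < τ := hx₀.trans_lt hx₀τ
  have hTc := continuous_travelTime hP hP0
  suffices key : ∀ σ > 0, σ * τ ≤ 1 →
      x₀ k - σ * (τ * x₀ k - x₀ k ^ 2 / 2) ≤ travelTime P (u x₀) by
    have hlim : Tendsto (fun σ : ℝ => x₀ k - σ * (τ * x₀ k - x₀ k ^ 2 / 2))
        (nhdsWithin 0 (Ioi 0)) (nhds (x₀ k)) := by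
      have : Continuous fun σ : ℝ => x₀ k - σ * (τ * x₀ k - x₀ k ^ 2 / 2) := by fun_prop
      simpa using (this.tendsto 0).mono_left nhdsWithin_le_nhds
    refine le_of_tendsto hlim ?_
    have h1 : ∀ᶠ σ : ℝ in nhdsWithin 0 (Ioi 0), σ < 1 / τ :=
      mem_nhdsWithin_of_mem_nhds (gt_mem_nhds (by positivity))
    filter_upwards [h1, self_mem_nhdsWithin] with σ h1 h2
    exact key σ h2 ((lt_div_iff₀ hτ0).1 h1).le
  intro σ hσ hστ
  by_contra! hlt
  set θ : ℝ → ℝ := fun t => 0 + (1 - σ * τ) * t + σ / 2 * t ^ 2 with hθ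
  have hθle : ∀ t ∈ Icc 0 τ, θ t ≤ t := by
    intro t ht
    have : 0 ≤ σ * (t * (τ - t / 2)) :=
      mul_nonneg hσ.le (mul_nonneg ht.1 (by linarith [ht.1, ht.2]))
    simp only [hθ]; nlinarith
  set D := θ (x₀ k) - travelTime P (u x₀) with hD
  have hD0 : 0 < D := by simp only [hD, hθ]; linarith
  obtain ⟨δ, hδ, hδ1, hδ2, hδ3⟩ : ∃ δ > 0, δ * sqDist 0 x₀ < D ∧
      2 * N * δ + G * (4 * δ * τ) / Real.sqrt (2 * κ) < σ ∧ 2 * δ * τ < 1 := by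
    have h1 : Tendsto (fun δ : ℝ => δ * sqDist 0 x₀) (nhdsWithin 0 (Ioi 0)) (nhds 0) := by
      have : Continuous fun δ : ℝ => δ * sqDist 0 x₀ := by fun_prop
      simpa using (this.tendsto 0).mono_left nhdsWithin_le_nhds
    have h2 : Tendsto (fun δ : ℝ => 2 * N * δ + G * (4 * δ * τ) / Real.sqrt (2 * κ))
        (nhdsWithin 0 (Ioi 0)) (nhds 0) := by
      have : Continuous fun δ : ℝ => 2 * N * δ + G * (4 * δ * τ) / Real.sqrt (2 * κ) := by
        fun_prop
      simpa using (this.tendsto 0).mono_left nhdsWithin_le_nhds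
    have h3 : Tendsto (fun δ : ℝ => 2 * δ * τ) (nhdsWithin 0 (Ioi 0)) (nhds 0) := by
      have : Continuous fun δ : ℝ => 2 * δ * τ := by fun_prop
      simpa using (this.tendsto 0).mono_left nhdsWithin_le_nhds
    obtain ⟨δ, ⟨a, b, c⟩, d⟩ := (((h1.eventually (gt_mem_nhds hD0)).and
      ((h2.eventually (gt_mem_nhds hσ)).and (h3.eventually (gt_mem_nhds one_pos)))).and
      self_mem_nhdsWithin).exists
    exact ⟨δ, d, a, b, c⟩
  set S : Set (Fin N → ℝ) := {x | x k ∈ Icc 0 τ} ∩ u ⁻¹' Iic b with hS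
  have hslab : IsClosed {x : Fin N → ℝ | x k ∈ Icc 0 τ} :=
    isClosed_Icc.preimage (continuous_apply k)
  have hcS : ContinuousOn u {x : Fin N → ℝ | x k ∈ Icc 0 τ} := hu.cont.mono fun x hx => hx.1
  have hSc : IsClosed S := hcS.preimage_isClosed_of_isClosed hslab isClosed_Iic
  have hT0 : ∀ x : Fin N → ℝ, 0 ≤ x k → 0 ≤ travelTime P (u x) := by
    intro x hx
    have := travelTime_mono hP hP0 (hu.nonneg x hx)
    rwa [travelTime_zero] at this
  obtain ⟨x, hx, hmax⟩ := exists_penalized_max hSc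
    (g := fun x => θ (x k) - travelTime P (u x)) (B := τ)
    ((Continuous.continuousOn (by simp only [hθ]; fun_prop)).sub
      (hTc.comp_continuousOn (hcS.mono inter_subset_left)))
    (fun x hx => by
      have h1 := hθle _ hx.1
      have h2 := hT0 x hx.1.1
      have h3 := hx.1.2
      linarith) (x₀ := x₀) ⟨⟨hx₀, hx₀τ.le⟩, hub.le⟩ hδ
  have hge := hmax x₀ ⟨⟨hx₀, hx₀τ.le⟩, hub.le⟩
  have hsq := sqDist_nonneg 0 x
  have hpos : 0 < θ (x k) - travelTime P (u x) - δ * sqDist 0 x := by linarith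
  have hsq' : 0 ≤ δ * sqDist 0 x := by positivity
  have hθx := hθle _ hx.1
  have hTx := hT0 x hx.1.1
  have hxk : 0 < x k := by
    rcases eq_or_lt_of_le hx.1.1 with h | h
    · exfalso
      linarith
    · exact h
  have hub' : u x < b := by
    rcases eq_or_lt_of_le (show u x ≤ b from hx.2) with h | h
    · exfalso
      rw [h] at hpos
      linarith [hx.1.2]
    · exact h
  have hxτ : x k < τ := by
    by_contra! hcon
    linarith [hτ x hcon]
  have hucont : ContinuousAt u x := hu.cont.continuousAt (mem_of_superset
    ((isOpen_lt continuous_const (continuous_apply k)).mem_nhds hxk)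
      fun y (hy : 0 < y k) => hy.le)
  have hlm : IsLocalMax (fun y => (θ (y k) - travelTime P (u y)) - δ * sqDist 0 y) x := by
    filter_upwards [(isOpen_lt continuous_const (continuous_apply k)).mem_nhds hxk,
      (isOpen_lt (continuous_apply k) continuous_const).mem_nhds hxτ,
      hucont.eventually (gt_mem_nhds hub')] with y hy1 hy2 hy3
    exact hmax y ⟨⟨le_of_lt hy1, le_of_lt hy2⟩, hy3.le⟩
  obtain ⟨p, q, hpq, hq⟩ := hu.pde x hxk
  have hux : u x ∈ Icc 0 z := ⟨hu.nonneg x hxk.le, hu.le x hxk.le⟩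
  have hpd := ((HasPureDerivs.coord (k := k) (HasSecondDeriv.quadratic 0 (1 - σ * τ) (σ / 2)
    (x k))).sub (HasPureDerivs.comp (hasSecondDeriv_travelTime hP hP0 (hP' (u x))) hpq)).sub
    ((hasPureDerivs_sqDist 0 x).const_mul δ)
  obtain ⟨hp0, hq0⟩ := hpd.of_isLocalMax hlm
  have hsum := Finset.sum_nonpos fun i (_ : i ∈ Finset.univ) => hq0 i
  set r := Real.sqrt (2 * P (u x)) with hr
  have hr0 : 0 < r := Real.sqrt_pos.2 (by linarith [hP0 (u x)])
  have hr2 : 2 * P (u x) = r ^ 2 := (Real.sq_sqrt (by linarith [hP0 (u x)])).symm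
  have hrκ : Real.sqrt (2 * κ) ≤ r := Real.sqrt_le_sqrt (by linarith [hPκ (u x)])
  simp only [Pi.sub_apply, Pi.smul_apply, smul_eq_mul, Finset.sum_sub_distrib,
    Finset.sum_add_distrib, ← Finset.mul_sum, hq, Finset.sum_const, Finset.card_univ,
    Fintype.card_fin, nsmul_eq_mul, Finset.sum_pi_single', Finset.mem_univ, if_true, hr2] at hsum
  simp only [Pi.sub_apply, Pi.smul_apply, smul_eq_mul, Pi.zero_apply, sub_zero] at hp0
  have hpi : ∀ i, p i ^ 2 ≤ r ^ 2 * (Pi.single (M := fun _ => ℝ) k 1 i + 4 * δ ^ 2 * (x i) ^ 2) := by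
    intro i
    have h1 := hp0 i
    by_cases hik : i = k
    · subst hik
      simp only [Pi.single_eq_same] at h1 ⊢
      set c := 1 - σ * τ + 2 * (σ / 2) * x i - δ * (2 * x i) with hc
      have h2 : p i = r * c := by
        have : 1 / r * p i = c := by rw [hc]; linarith
        rw [← this]; field_simp
      have h3 : 0 ≤ σ * (τ - x i) := mul_nonneg hσ.le (by linarith)
      have h4 : 0 ≤ σ * x i := by positivity
      have h5 : 0 ≤ δ * x i := by positivity
      have h6 : δ * x i ≤ δ * τ := by gcongr
      have h7 : c ^ 2 ≤ 1 := by
        rw [sq_le_one_iff_abs_le_one, abs_le]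
        constructor <;> rw [hc] <;> linarith
      rw [h2, mul_pow]
      have h8 : 0 ≤ 4 * δ ^ 2 * x i ^ 2 := by positivity
      gcongr
      linarith
    · simp only [Pi.single_eq_of_ne hik] at h1 ⊢
      have h2 : p i = r * (-(2 * δ * x i)) := by
        have : 1 / r * p i = -(2 * δ * x i) := by linarith
        rw [← this]; field_simp
      rw [h2]
      apply le_of_eq; ring
  have hSp : ∑ i, p i ^ 2 ≤ r ^ 2 * (1 + 4 * δ * τ) := by
    calc ∑ i, p i ^ 2 ≤ ∑ i, r ^ 2 * (Pi.single (M := fun _ => ℝ) k 1 i + 4 * δ ^ 2 * (x i) ^ 2) :=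
          Finset.sum_le_sum fun i _ => hpi i
      _ = r ^ 2 * (1 + 4 * δ * (δ * sqDist 0 x)) := by
          rw [← Finset.mul_sum, Finset.sum_add_distrib, Finset.sum_pi_single', ← Finset.mul_sum]
          simp only [Finset.mem_univ, if_true, sqDist, Pi.zero_apply, sub_zero]
          ring
      _ ≤ _ := by
          gcongr
          linarith
  rw [← hgf _ hux] at hsum
  set A := energyGap g b (u x) with hAdef
  have hA0 : 0 ≤ A := energyGap_nonneg hg0 hub'.le
  set ν := A / Real.sqrt (A ^ 2 + η ^ 2) with hν
  have hν1 : ν ≤ 1 := by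
    refine div_le_one_of_le₀ ?_ (Real.sqrt_nonneg _)
    exact Real.le_sqrt_of_sq_le (by nlinarith)
  have hν0 : 0 ≤ ν := by positivity
  have hgu := hg0 (u x)
  have h1 : g (u x) * ν / (r ^ 2 * r) * ∑ i, p i ^ 2 ≤ g (u x) / r * (1 + 4 * δ * τ) := by
    calc g (u x) * ν / (r ^ 2 * r) * ∑ i, p i ^ 2
        ≤ g (u x) * 1 / (r ^ 2 * r) * (r ^ 2 * (1 + 4 * δ * τ)) := by gcongr
      _ = _ := by field_simp
  have h2 : g (u x) / r * (4 * δ * τ) ≤ G * (4 * δ * τ) / Real.sqrt (2 * κ) := by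
    rw [div_mul_eq_mul_div]
    have := hG (u x)
    have : 0 < Real.sqrt (2 * κ) := Real.sqrt_pos.2 (by positivity)
    gcongr
  have h3 : 1 / r * -g (u x) = -(g (u x) / r) := by ring
  rw [h3] at hsum
  linarith

end IsHalfSpaceSol

lemma sqrt_sq_add_sq_sub_le {a η : ℝ} (hη : 0 < η) :
    Real.sqrt (a ^ 2 + η ^ 2) - η ≤ a ^ 2 / (2 * η) := by
  have h1 : Real.sqrt (a ^ 2 + η ^ 2) ≤ η + a ^ 2 / (2 * η) := by
    refine Real.sqrt_le_iff.2 ⟨by positivity, ?_⟩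
    have e : (η + a ^ 2 / (2 * η)) ^ 2 = η ^ 2 + a ^ 2 + (a ^ 2 / (2 * η)) ^ 2 := by
      field_simp; ring
    rw [e]
    nlinarith [sq_nonneg (a ^ 2 / (2 * η))]
  linarith

/-- The travel time to the level `b` of the approximating subsolutions is arbitrarily large. -/
lemma exists_le_travelTime {g : ℝ → ℝ} {G b η : ℝ} (hg : Continuous g) (hg0 : ∀ s, 0 ≤ g s)
    (hG : ∀ s, g s ≤ G) (hb : 0 < b) (hη : 0 < η) (τ : ℝ) :
    ∃ κ > 0, τ ≤ travelTime (fun s => Real.sqrt (energyGap g b s ^ 2 + η ^ 2) - η + κ) b := by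
  have hG0 : 0 ≤ G := (hg0 0).trans (hG 0)
  have hrη : 0 < Real.sqrt η := Real.sqrt_pos.2 hη
  set d := G / Real.sqrt η + 1 with hd
  have hd0 : 0 < d := by positivity
  have hdG : G ^ 2 / η ≤ d ^ 2 := by
    have h1 : G ^ 2 / η = (G / Real.sqrt η) ^ 2 := by rw [div_pow, Real.sq_sqrt hη.le]
    rw [h1, hd]
    gcongr
    linarith
  set e := d * b * Real.exp (-(d * τ)) with he
  have he0 : 0 < e := by positivity
  refine ⟨e ^ 2 / 2, by positivity, ?_⟩
  set P : ℝ → ℝ := fun s => Real.sqrt (energyGap g b s ^ 2 + η ^ 2) - η + e ^ 2 / 2 with hPdef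
  have hA := continuous_energyGap hg b
  have hP : Continuous P := by simp only [hPdef]; fun_prop
  have hP0 : ∀ s, 0 < P s := by
    intro s
    have : η ≤ Real.sqrt (energyGap g b s ^ 2 + η ^ 2) :=
      Real.le_sqrt_of_sq_le (by nlinarith [sq_nonneg (energyGap g b s)])
    have : 0 < e ^ 2 / 2 := by positivity
    simp only [hPdef]
    linarith
  have hden : ∀ s ∈ Icc 0 b, 0 < d * (b - s) + e := fun s hs =>
    add_pos_of_nonneg_of_pos (mul_nonneg hd0.le (by linarith [hs.2])) he0
  have hle : ∀ s ∈ Icc 0 b, 1 / (d * (b - s) + e) ≤ 1 / Real.sqrt (2 * P s) := by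
    intro s hs
    have h0 : 0 < Real.sqrt (2 * P s) := Real.sqrt_pos.2 (by linarith [hP0 s])
    refine one_div_le_one_div_of_le h0 (Real.sqrt_le_iff.2 ⟨(hden s hs).le, ?_⟩)
    have h1 := sqrt_sq_add_sq_sub_le (a := energyGap g b s) hη
    have h2 : energyGap g b s ^ 2 ≤ (G * (b - s)) ^ 2 := by
      have := energyGap_nonneg hg0 hs.2
      have := energyGap_le_mul hg hG hs.2
      gcongr
    have h3 : energyGap g b s ^ 2 / η ≤ d ^ 2 * (b - s) ^ 2 := by
      calc energyGap g b s ^ 2 / η ≤ (G * (b - s)) ^ 2 / η := by gcongr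
        _ = G ^ 2 / η * (b - s) ^ 2 := by ring
        _ ≤ _ := by gcongr
    have h4 : energyGap g b s ^ 2 / (2 * η) = energyGap g b s ^ 2 / η / 2 := by
      field_simp
    have h5 : 0 ≤ d * (b - s) * e := mul_nonneg (mul_nonneg hd0.le (by linarith [hs.2])) he0.le
    simp only [hPdef]
    nlinarith
  have h_int : ContinuousOn (fun s => 1 / (d * (b - s) + e)) (uIcc 0 b) := by
    rw [uIcc_of_le hb.le]
    exact continuousOn_const.div (by fun_prop) fun s hs => (hden s hs).ne'
  have hmono := intervalIntegral.integral_mono_on (μ := MeasureTheory.volume) hb.le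
    h_int.intervalIntegrable ((continuous_slowness hP hP0).intervalIntegrable 0 b) hle
  have hFTC := intervalIntegral.integral_eq_sub_of_hasDerivAt
    (f := fun s => -(1 / d) * Real.log (d * (b - s) + e)) (fun s hs => by
      rw [uIcc_of_le hb.le] at hs
      have h1 : HasDerivAt (fun s => d * (b - s) + e) (-d) s :=
        ((((hasDerivAt_id s).const_sub b).const_mul d).add_const e).congr_deriv (by ring)
      exact ((h1.log (hden s hs).ne').const_mul (-(1 / d))).congr_deriv
        (show _ = 1 / (d * (b - s) + e) by
          have := (hden s hs).ne'
          field_simp)) h_int.intervalIntegrable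
  rw [hFTC] at hmono
  refine le_trans ?_ hmono
  have h6 : Real.log e = Real.log (d * b) + -(d * τ) := by
    rw [he, Real.log_mul (by positivity) (Real.exp_pos _).ne', Real.log_exp]
  have h7 : Real.log (d * b) ≤ Real.log (d * b + e) := Real.log_le_log (by positivity) (by linarith)
  simp only [sub_self, mul_zero, zero_add, sub_zero]
  rw [h6]
  have h8 : τ = 1 / d * (d * τ) := by field_simp
  have h9 : 1 / d * Real.log (d * b) ≤ 1 / d * Real.log (d * b + e) := by gcongr
  linarith

namespace IsHalfSpaceSol

variable {N : ℕ} {k : Fin N} {f g : ℝ → ℝ} {z : ℝ} {u : (Fin N → ℝ) → ℝ}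

/-- A solution bounded by its positive lower limit depends on the height only. -/
lemma le_of_height_eq (hu : IsHalfSpaceSol k f z u) (hfar : farInf k u = z) (hg : Continuous g)
    (hg0 : ∀ s, 0 ≤ g s) (hgf : ∀ s ∈ Icc 0 z, g s = f s) (hgz : ∀ s, z ≤ s → g s = 0)
    {G : ℝ} (hG : ∀ s, g s ≤ G) (hgap : ∀ s, 0 ≤ s → s < z → 0 < energyGap g z s)
    {x y : Fin N → ℝ} (hx : 0 ≤ x k) (hxy : x k = y k) : u y ≤ u x := by
  by_contra! hlt
  have hy : 0 ≤ y k := hxy ▸ hx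
  set w := u x with hw
  set w' := u y with hw'
  have hw0 : 0 ≤ w := hu.nonneg x hx
  have hw'z : w' ≤ z := hu.le y hy
  have hwz : w < z := hlt.trans_le hw'z
  set m := energyGap g z w with hm
  have hm0 : 0 < m := hgap w hw0 hwz
  have hA := continuous_energyGap hg z
  set C := energyGap g z 0 + 1 with hC
  have hC0 : 0 < C := by
    have := energyGap_nonneg hg0 (hw0.trans hwz.le)
    positivity
  set c₀ := 1 / Real.sqrt (2 * C) with hc₀
  have hc₀0 : 0 < c₀ := by
    have : 0 < Real.sqrt (2 * C) := Real.sqrt_pos.2 (by positivity)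
    positivity
  obtain ⟨τ, hτ0, hτ1, hτm, hτc⟩ : ∃ τ > 0, τ < 1 ∧ τ < m / 2 ∧
      w * (4 * τ / (m * Real.sqrt m)) < (w' - w) * c₀ := by
    have h1 : Tendsto (fun τ : ℝ => w * (4 * τ / (m * Real.sqrt m)))
        (nhdsWithin 0 (Ioi 0)) (nhds 0) := by
      have : Continuous fun τ : ℝ => w * (4 * τ / (m * Real.sqrt m)) := by fun_prop
      simpa using (this.tendsto 0).mono_left nhdsWithin_le_nhds
    have h2 : ∀ᶠ τ : ℝ in nhdsWithin 0 (Ioi 0), τ < 1 :=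
      mem_nhdsWithin_of_mem_nhds (gt_mem_nhds one_pos)
    have h3 : ∀ᶠ τ : ℝ in nhdsWithin 0 (Ioi 0), τ < m / 2 :=
      mem_nhdsWithin_of_mem_nhds (gt_mem_nhds (half_pos hm0))
    obtain ⟨τ, ⟨⟨a, b⟩, c⟩, d⟩ := (((h2.and h3).and (h1.eventually (gt_mem_nhds
      (mul_pos (sub_pos.2 hlt) hc₀0)))).and self_mem_nhdsWithin).exists
    exact ⟨τ, d, a, b, c⟩
  obtain ⟨b, hwb, hbz, hAb⟩ : ∃ b, w < b ∧ b < z ∧ energyGap g z b < τ / 2 := by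
    have h1 : ∀ᶠ b in nhdsWithin z (Iio z), energyGap g z b < τ / 2 :=
      mem_nhdsWithin_of_mem_nhds ((hA.tendsto z).eventually
        (gt_mem_nhds (by rw [energyGap_self]; positivity)))
    have h2 : ∀ᶠ b in nhdsWithin z (Iio z), w < b :=
      mem_nhdsWithin_of_mem_nhds (lt_mem_nhds hwz)
    obtain ⟨b, ⟨a, b'⟩, c⟩ := ((h1.and h2).and self_mem_nhdsWithin).exists
    exact ⟨b, b', c, a⟩
  have hη : 0 < τ / 2 := by positivity
  obtain ⟨t, -, ht⟩ := hu.exists_height (c := b) (by rw [hfar]; exact hbz)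
  obtain ⟨κ, hκ, hκt⟩ := exists_le_travelTime hg hg0 hG (hw0.trans_lt hwb) hη t
  have hlow := hu.le_travelTime hg hg0 hgf hG hη hκ ht hκt hx hwb
  have hup := hu.travelTime_le hg hg0 hgf hgz hτ0 hy
  set P : ℝ → ℝ := fun s => Real.sqrt (energyGap g b s ^ 2 + (τ / 2) ^ 2) - τ / 2 + κ with hPdef
  set Q : ℝ → ℝ := fun s => energyGap g z s + τ * Real.exp (-s) with hQdef
  have hAbc := continuous_energyGap hg b
  have hPc : Continuous P := by simp only [hPdef]; fun_prop
  have hQc : Continuous Q := by simp only [hQdef]; fun_prop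
  have hP0 : ∀ s, 0 < P s := by
    intro s
    have : τ / 2 ≤ Real.sqrt (energyGap g b s ^ 2 + (τ / 2) ^ 2) :=
      Real.le_sqrt_of_sq_le (by nlinarith [sq_nonneg (energyGap g b s)])
    simp only [hPdef]
    linarith
  have hQ0 : ∀ s, 0 < Q s := by
    intro s
    have : 0 ≤ energyGap g z s := by
      rcases le_total s z with h | h
      · exact energyGap_nonneg hg0 h
      · exact (energyGap_eq_zero hgz h).ge
    simp only [hQdef]
    positivity
  have hQle : ∀ s, 0 ≤ s → Q s ≤ energyGap g z s + τ := by
    intro s hs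
    have : Real.exp (-s) ≤ 1 := Real.exp_le_one_iff.2 (by linarith)
    simp only [hQdef]
    nlinarith
  have hgain : (w' - w) * c₀ ≤ travelTime Q w' - travelTime Q w := by
    refine mul_le_travelTime_sub hQc hQ0 hlt.le fun s hs => ?_
    have h1 := hQle s (hw0.trans hs.1)
    have h2 := energyGap_anti hg hg0 (b := z) (hw0.trans hs.1)
    simp only [hC]
    linarith
  have hdiff : travelTime P w - travelTime Q w ≤ w * (4 * τ / (m * Real.sqrt m)) := by
    have h1 : travelTime P w - travelTime Q w =
        ∫ s in (0:ℝ)..w, (1 / Real.sqrt (2 * P s) - 1 / Real.sqrt (2 * Q s)) :=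
      (intervalIntegral.integral_sub ((continuous_slowness hPc hP0).intervalIntegrable _ _)
        ((continuous_slowness hQc hQ0).intervalIntegrable _ _)).symm
    have h2 := intervalIntegral.integral_mono_on (μ := MeasureTheory.volume) hw0
      (((continuous_slowness hPc hP0).sub (continuous_slowness hQc hQ0)).intervalIntegrable 0 w)
      ((continuous_const (y := 4 * τ / (m * Real.sqrt m))).intervalIntegrable 0 w)
      fun s hs => ?_
    · rw [intervalIntegral.integral_const, smul_eq_mul, sub_zero] at h2
      rw [h1]
      exact h2
    · have hms : m ≤ energyGap g z s := energyGap_anti hg hg0 hs.2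
      have h3 : energyGap g z s - τ ≤ P s := by
        have e1 := energyGap_sub hg (z := z) (b := b) (s := s)
        have e2 : energyGap g b s ≤ Real.sqrt (energyGap g b s ^ 2 + (τ / 2) ^ 2) :=
          Real.le_sqrt_of_sq_le (by nlinarith [sq_nonneg (τ / 2)])
        simp only [hPdef]
        linarith
      have h4 := hQle s hs.1
      have h5 := one_div_sqrt_sub_le hm0 (X := 2 * (energyGap g z s - τ))
        (Y := 2 * (energyGap g z s + τ)) (by linarith) (by linarith)
      have h6 : 1 / Real.sqrt (2 * P s) ≤ 1 / Real.sqrt (2 * (energyGap g z s - τ)) := by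
        have : 0 < Real.sqrt (2 * (energyGap g z s - τ)) := Real.sqrt_pos.2 (by linarith)
        gcongr
      have h7 : 1 / Real.sqrt (2 * (energyGap g z s + τ)) ≤ 1 / Real.sqrt (2 * Q s) := by
        have : 0 < Real.sqrt (2 * Q s) := Real.sqrt_pos.2 (by linarith [hQ0 s])
        gcongr
      have h8 : 2 * (energyGap g z s + τ) - 2 * (energyGap g z s - τ) = 4 * τ := by ring
      rw [h8] at h5
      simp only [Pi.sub_apply]
      linarith
  linarith

end IsHalfSpaceSol

/-! ### The one-dimensional profile -/

lemma LocLipOn.continuousOn {f : ℝ → ℝ} (h : LocLipOn f) : ContinuousOn f (Ici 0) := by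
  intro s hs
  obtain ⟨L, hL⟩ := h (s + 1)
  refine (hL.continuousOn s ⟨hs, by linarith⟩).mono_of_mem_nhdsWithin ?_
  rw [mem_nhdsWithin]
  exact ⟨Iio (s + 1), isOpen_Iio, by simp, fun t ht => ⟨ht.2, ht.1.le⟩⟩

lemma LocLipOn.exists_abs_sub_le {f : ℝ → ℝ} (h : LocLipOn f) (b : ℝ) :
    ∃ L, 0 ≤ L ∧ ∀ s ∈ Icc 0 b, ∀ t ∈ Icc 0 b, |f s - f t| ≤ L * |s - t| := by
  obtain ⟨L, hL⟩ := h b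
  refine ⟨L, L.2, fun s hs t ht => ?_⟩
  simpa [Real.dist_eq] using hL.dist_le_mul s hs t ht

/-- Under (H2), `f` is positive somewhere in `[s, z]` for every `0 ≤ s < z`. -/
lemma H2.exists_pos {f : ℝ → ℝ} (hf : H2 f) {s z : ℝ} (hs : 0 ≤ s) (hsz : s < z) :
    ∃ v ∈ Icc s z, 0 < f v := by
  rcases (hf.2.1 s hs).eq_or_lt with h | h
  · obtain ⟨c, hc, hev⟩ := hf.2.2 s hs h.symm
    obtain ⟨v, hv, hv1⟩ := (hev.and (Ioo_mem_nhdsGT hsz)).exists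
    have hvs : 0 < v - s := sub_pos.2 hv1.1
    refine ⟨v, ⟨hv1.1.le, hv1.2.le⟩, ?_⟩
    by_contra! hle
    have := div_nonpos_of_nonpos_of_nonneg hle hvs.le
    linarith
  · exact ⟨s, ⟨le_rfl, hsz.le⟩, h⟩

/-- A continuous function with second derivative `-h` on `(0, ∞)`, where `h` is continuous, is
twice differentiable up to `0`. -/
lemma exists_hasDerivWithinAt_Ici {V h : ℝ → ℝ} (hV : Continuous V) (hh : Continuous h)
    (hpos : ∀ t, 0 < t → ∃ p, HasSecondDeriv V t p (-h t)) :
    ∃ V' : ℝ → ℝ, (∀ ξ ∈ Ici (0:ℝ), HasDerivWithinAt V (V' ξ) (Ici 0) ξ) ∧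
      ∀ ξ ∈ Ici (0:ℝ), HasDerivWithinAt V' (-h ξ) (Ici 0) ξ := by
  set W : ℝ → ℝ := fun ξ => deriv V 1 + ∫ s in ξ..1, h s with hW
  have hWd : ∀ ξ, HasDerivAt W (-h ξ) ξ := fun ξ =>
    (intervalIntegral.integral_hasDerivAt_left (hh.intervalIntegrable _ _)
      (hh.stronglyMeasurableAtFilter _ _) hh.continuousAt).const_add _
  have hVd : ∀ t, 0 < t → HasDerivAt (deriv V) (-h t) t := fun t ht => by
    obtain ⟨p, V', h1, h2, -⟩ := hpos t ht
    exact h2.congr_of_eventuallyEq (HasSecondDeriv.deriv_eventuallyEq h1)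
  have hsub : ∀ t, 0 < t → HasDerivAt (fun s => deriv V s - W s) 0 t := fun t ht =>
    ((hVd t ht).sub (hWd t)).congr_deriv (by ring)
  have heq : ∀ t, 0 < t → deriv V t = W t := fun t ht => by
    have := isOpen_Ioi.is_const_of_deriv_eq_zero (convex_Ioi (0:ℝ)).isPreconnected
      (fun s hs => (hsub s hs).differentiableAt.differentiableWithinAt)
      (fun s hs => (hsub s hs).deriv) (x := t) (y := 1) ht (by simp)
    simp only [hW, intervalIntegral.integral_same] at this
    simp only [hW]
    linarith
  have hdV : ∀ t, 0 < t → HasDerivAt V (W t) t := fun t ht => by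
    obtain ⟨p, hp⟩ := hpos t ht
    rw [← heq t ht]
    exact hp.hasDerivAt.differentiableAt.hasDerivAt
  refine ⟨W, fun ξ hξ => ?_, fun ξ _ => (hWd ξ).hasDerivWithinAt⟩
  rcases (mem_Ici.1 hξ).eq_or_lt with rfl | hξ
  · refine hasDerivWithinAt_Ici_of_tendsto_deriv (s := Ioi 0)
      (fun t ht => (hdV t ht).differentiableAt.differentiableWithinAt)
      hV.continuousWithinAt self_mem_nhdsWithin ?_
    have : Tendsto W (nhdsWithin 0 (Ioi 0)) (nhds (W 0)) :=
      (hWd 0).continuousAt.tendsto.mono_left nhdsWithin_le_nhds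
    refine this.congr' ?_
    filter_upwards [self_mem_nhdsWithin] with t ht using (heq t ht).symm
  · exact (hdV ξ hξ).hasDerivWithinAt

namespace IsHalfSpaceSol

variable {N : ℕ} {k : Fin N} {f g : ℝ → ℝ} {z L : ℝ} {u : (Fin N → ℝ) → ℝ}

/-- A solution bounded by a zero `z` of `f` stays strictly below `z`. -/
lemma lt_of_apply_eq_zero (hu : IsHalfSpaceSol k f z u) (hz : 0 < z) (hfz : f z = 0)
    (hL0 : 0 ≤ L) (hL : ∀ s ∈ Icc 0 z, ∀ t ∈ Icc 0 z, |f s - f t| ≤ L * |s - t|)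
    {x : Fin N → ℝ} (hx : 0 ≤ x k) : u x < z := by
  have hK : 0 < L + 1 := by linarith
  have key := barrier_le_of_lap_le (k := k) (w := fun y => z - u y) (K := L + 1) (η := z)
    (b := x k + 1) hK hz (by linarith)
    (continuousOn_const.sub (hu.cont.mono fun y hy => hy.1))
    (fun y hy => sub_nonneg.2 (hu.le y hy.1))
    (fun y hy => by simp [hu.dir y hy]) ?_ (x := x) ⟨hx, by linarith⟩
  · have h1 : 0 < Real.exp ((L + 1) * (x k + 1 - x k)) - 1 := by
      rw [sub_pos, Real.one_lt_exp_iff]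
      simpa using hK
    have h2 : 0 < z * Real.exp (-((L + 1) * (x k + 1))) := by positivity
    have := mul_pos h2 h1
    linarith
  · intro y hy
    obtain ⟨p, q, hpq, hq⟩ := hu.pde y hy.1
    refine ⟨_, _, (HasPureDerivs.const z y).sub hpq, ?_⟩
    have hy0 := hu.nonneg y hy.1.le
    have hyz := hu.le y hy.1.le
    have h1 := hL (u y) ⟨hy0, hyz⟩ z ⟨hz.le, le_rfl⟩
    rw [hfz, sub_zero, abs_sub_comm, abs_of_nonneg (sub_nonneg.2 hyz)] at h1
    have h2 := (le_abs_self _).trans h1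
    have h3 : L * (z - u y) ≤ (L + 1) ^ 2 * (z - u y) :=
      mul_le_mul_of_nonneg_right (by nlinarith) (sub_nonneg.2 hyz)
    simp only [Pi.sub_apply, Pi.zero_apply, zero_sub, Finset.sum_neg_distrib, hq]
    linarith

/-- The restriction of `u` to the `k`-th coordinate axis, extended by `u 0` to `(-∞, 0]`. -/
def axis (k : Fin N) (u : (Fin N → ℝ) → ℝ) (t : ℝ) : ℝ := u (Function.update 0 k (max t 0))

lemma continuous_axis (hu : IsHalfSpaceSol k f z u) : Continuous (axis k u) := by
  refine hu.cont.comp_continuous (f := fun t : ℝ => Function.update (0 : Fin N → ℝ) k (max t 0))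
    ?_ fun t => ?_
  · exact continuous_const.update k (by fun_prop)
  · simp

lemma axis_mem (hu : IsHalfSpaceSol k f z u) (t : ℝ) : axis k u t ∈ Icc 0 z :=
  ⟨hu.nonneg _ (by simp), hu.le _ (by simp)⟩

lemma eq_axis (hsym : ∀ x y : Fin N → ℝ, 0 ≤ x k → x k = y k → u x = u y) {x : Fin N → ℝ}
    (hx : 0 ≤ x k) : u x = axis k u (x k) :=
  hsym _ _ hx (by simp [hx])

lemma hasSecondDeriv_axis (hu : IsHalfSpaceSol k f z u)
    (hsym : ∀ x y : Fin N → ℝ, 0 ≤ x k → x k = y k → u x = u y) {t : ℝ} (ht : 0 < t) :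
    ∃ p, HasSecondDeriv (axis k u) t p (-f (axis k u t)) := by
  set x : Fin N → ℝ := Function.update 0 k t with hx
  have hxk : x k = t := by simp [hx]
  have hux : u x = axis k u t := by rw [eq_axis hsym (by rw [hxk]; exact ht.le), hxk]
  obtain ⟨p, q, hpq, hq⟩ := hu.pde x (by rwa [hxk])
  have hother : ∀ i ≠ k, q i = 0 := fun i hi => by
    have hc : (fun s => u (Function.update x i s)) = fun _ => u x := by
      funext s
      have hk : Function.update x i s k = x k := Function.update_of_ne hi.symm _ _
      exact hsym _ _ (by rw [hk, hxk]; exact ht.le) hk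
    have h := hpq i
    rw [hc] at h
    rw [← h.deriv_deriv, (HasSecondDeriv.const (u x) (x i)).deriv_deriv]
  rw [Finset.sum_eq_single k (fun i _ hi => hother i hi) (by simp), hux] at hq
  refine ⟨p k, ?_⟩
  have h := hpq k
  rw [hxk, hq] at h
  refine h.congr ?_
  filter_upwards [lt_mem_nhds ht] with s hs
  simp [axis, hx, hs.le]

/-- A one-dimensional solution below its positive limit at infinity is a profile. -/
lemma exists_isProfile (hu : IsHalfSpaceSol k f z u) (hfar : farInf k u = z) (hz : 0 < z)
    (hf : ∀ s, 0 ≤ s → 0 ≤ f s) (hfz : f z = 0) (hg : Continuous g)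
    (hgf : ∀ s ∈ Icc 0 z, g s = f s) (hL0 : 0 ≤ L)
    (hL : ∀ s ∈ Icc 0 z, ∀ t ∈ Icc 0 z, |f s - f t| ≤ L * |s - t|)
    (hsym : ∀ x y : Fin N → ℝ, 0 ≤ x k → x k = y k → u x = u y) :
    ∃ V', IsProfile f z (axis k u) V' := by
  have hgV : ∀ t, g (axis k u t) = f (axis k u t) := fun t => hgf _ (hu.axis_mem t)
  obtain ⟨V', h1, h2⟩ := exists_hasDerivWithinAt_Ici (h := fun t => g (axis k u t))
    hu.continuous_axis (hg.comp hu.continuous_axis) fun t ht => by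
      simpa only [hgV] using hu.hasSecondDeriv_axis hsym ht
  simp only [hgV] at h2
  refine ⟨V', h1, h2, hu.dir _ (by simp), fun ξ hξ => ⟨?_, ?_⟩, ?_⟩
  · obtain ⟨η, hη, h⟩ := hu.exists_pos_le hf (hfar ▸ hz) hξ
    exact hη.trans_le (h _ (by simp))
  · exact hu.lt_of_apply_eq_zero hz hfz hL0 hL (by simp)
  · refine tendsto_order.2 ⟨fun c hc => ?_, fun c hc => ?_⟩
    · obtain ⟨d, hcd, hdz⟩ := exists_between hc
      obtain ⟨T, -, hT⟩ := hu.exists_height (c := d) (hfar ▸ hdz)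
      filter_upwards [eventually_ge_atTop T] with t ht
      exact hcd.trans_le (hT _ (by simp [ht]))
    · exact Eventually.of_forall fun t => (hu.axis_mem t).2.trans_lt hc

end IsHalfSpaceSol

/-- Theorem 2.6 (one-dimensional symmetry in the half-space): under (H2), every bounded
nonnegative solution of `Δu + f(u) = 0` in `ℝ^{N-1} × [0,+∞)` with `u = 0` on
`ℝ^{N-1} × {0}` depends only on the last variable; moreover either `u ≡ 0` or
`u(x) = V_z(x_N)` for some zero `z > 0` of `f`. -/
theorem stmt_6
    {N : ℕ} (hN : 1 ≤ N) (iN : Fin N) (hiN : (iN : ℕ) = N - 1)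
    (f : ℝ → ℝ) (hf : H2 f)
    (u : (Fin N → ℝ) → ℝ)
    (hu_smooth : ContDiffOn ℝ 2 u {x : Fin N → ℝ | 0 < x iN})
    (hu_cont : ContinuousOn u {x : Fin N → ℝ | 0 ≤ x iN})
    (hu_nonneg : ∀ x : Fin N → ℝ, 0 ≤ x iN → 0 ≤ u x)
    (hu_bdd : ∃ C, ∀ x : Fin N → ℝ, 0 ≤ x iN → u x ≤ C)
    (hu_pde : ∀ x : Fin N → ℝ, 0 < x iN → lap u x + f (u x) = 0)
    (hu_dir : ∀ x : Fin N → ℝ, x iN = 0 → u x = 0) :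
    (∀ x y : Fin N → ℝ, 0 ≤ x iN → 0 ≤ y iN → x iN = y iN → u x = u y) ∧
    ((∀ x : Fin N → ℝ, 0 ≤ x iN → u x = 0) ∨
      ∃ z : ℝ, 0 < z ∧ f z = 0 ∧ ∃ V V' : ℝ → ℝ, IsProfile f z V V' ∧
        ∀ x : Fin N → ℝ, 0 ≤ x iN → u x = V (x iN)) := by
  have hf0 := hf.2.1
  have hfc := hf.1.continuousOn
  obtain ⟨M, hM⟩ := hu_bdd
  have hopen : IsOpen {x : Fin N → ℝ | 0 < x iN} :=
    isOpen_lt continuous_const (continuous_apply iN)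
  have hu : IsHalfSpaceSol iN f M u := by
    refine ⟨fun x hx => ?_, hu_cont, hu_nonneg, hM, hu_dir⟩
    obtain ⟨p, q, hpq, hq⟩ :=
      HasPureDerivs.of_contDiffAt (hu_smooth.contDiffAt (hopen.mem_nhds hx))
    exact ⟨p, q, hpq, by linarith [hu_pde x hx]⟩
  obtain ⟨L, hL0, hL⟩ := hf.1.exists_abs_sub_le M
  obtain ⟨z, hz⟩ : ∃ z, IsHalfSpaceSol.farInf iN u = z := ⟨_, rfl⟩
  have hfz : f z = 0 := hz ▸ hu.apply_farInf_eq_zero hf0 hfc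
  have hzM : z ≤ M := hz ▸ hu.farInf_le
  have hle : ∀ x : Fin N → ℝ, 0 ≤ x iN → u x ≤ z := fun x hx =>
    hz ▸ hu.le_farInf_of_H2 hf hL0 hL (by rw [hz, hfz]) hx
  rcases (hz ▸ hu.farInf_nonneg : 0 ≤ z).eq_or_lt with hz0 | hz0
  · have h0 : ∀ x : Fin N → ℝ, 0 ≤ x iN → u x = 0 := fun x hx =>
      le_antisymm (hz0 ▸ hle x hx) (hu_nonneg x hx)
    exact ⟨fun x y hx hy _ => (h0 x hx).trans (h0 y hy).symm, Or.inl h0⟩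
  have huz : IsHalfSpaceSol iN f z u := ⟨hu.pde, hu.cont, hu.nonneg, hle, hu.dir⟩
  set g : ℝ → ℝ := IccExtend hz0.le (fun s : Icc 0 z => f s) with hgdef
  have hg : Continuous g :=
    ((hfc.mono Icc_subset_Ici_self).domRestrict).Icc_extend'
  have hgf : ∀ s ∈ Icc 0 z, g s = f s := fun s hs => IccExtend_of_mem hz0.le _ hs
  have hgz : ∀ s, z ≤ s → g s = 0 := fun s hs => by
    rw [hgdef, IccExtend_of_right_le hz0.le _ hs]; exact hfz
  have hg0 : ∀ s, 0 ≤ g s := fun s => hf0 _ (projIcc 0 z hz0.le s).2.1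
  obtain ⟨G, hG⟩ : ∃ G, ∀ s, g s ≤ G := by
    obtain ⟨G, hG⟩ := isCompact_Icc.bddAbove_image (hfc.mono (Icc_subset_Ici_self : Icc 0 z ⊆ Ici 0))
    exact ⟨G, fun s => hG (mem_image_of_mem f (projIcc 0 z hz0.le s).2)⟩
  have hgap : ∀ s, 0 ≤ s → s < z → 0 < energyGap g z s := fun s hs hsz => by
    obtain ⟨v, hv, hfv⟩ := hf.exists_pos hs hsz
    refine intervalIntegral.integral_pos hsz hg.continuousOn (fun _ _ => hg0 _) ⟨v, hv, ?_⟩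
    rwa [hgf v ⟨hs.trans hv.1, hv.2⟩]
  have hsym : ∀ x y : Fin N → ℝ, 0 ≤ x iN → x iN = y iN → u x = u y := fun x y hx hxy =>
    le_antisymm (huz.le_of_height_eq hz hg hg0 hgf hgz hG hgap (hxy ▸ hx) hxy.symm)
      (huz.le_of_height_eq hz hg hg0 hgf hgz hG hgap hx hxy)
  refine ⟨fun x y hx _ hxy => hsym x y hx hxy, Or.inr ⟨z, hz0, hfz, IsHalfSpaceSol.axis iN u, ?_⟩⟩
  obtain ⟨V', hV'⟩ := huz.exists_isProfile hz hz0 hf0 hfz hg hgf hL0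
    (fun s hs t ht => hL s ⟨hs.1, hs.2.trans hzM⟩ t ⟨ht.1, ht.2.trans hzM⟩) hsym
  exact ⟨V', hV', fun x hx => IsHalfSpaceSol.eq_axis hsym hx⟩
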